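/- Let d ∈ ℕ, d ≥ 2, let κ satisfy 1/2 ≤ κ ≤ 1 if d ≥ 3 and 1/2 < κ ≤ 1 if d = 2, and set q := 2d/(d−4+4κ). Then there exists a constant C > 0 such that for every Schwartz function u : ℝ^d → ℂ one has ‖u‖_q ≤ C · ‖∂_{tt}u − Δ_x u‖_2^{1−κ} · ‖u‖_2^{κ}, where z = (x,t) ∈ ℝ^{d−1} × ℝ are the space-time coordinates and (∂_{tt}u − Δ_x u)(z) := D²u(z)(e_d, e_d) − Σ_{i=1}^{d−1} D²u(z)(e_i, e_i), with D²u(z) the second (Fréchet) derivative of u at z and e_1,…,e_d the standard basis of ℝ^d. -/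

import Mathlib

open MeasureTheory Real SchwartzMap
open scoped FourierTransform ENNReal NNReal


namespace GNWave

open Complex ComplexConjugate

abbrev V (d : ℕ) := EuclideanSpace ℝ (Fin d)

lemma fourier_cont {d : ℕ} {g : V d → ℂ} (hg : Integrable g) : Continuous (𝓕 g) :=
  VectorFourier.fourierIntegral_continuous Real.continuous_fourierChar
    (innerSL ℝ).continuous₂ hg

lemma fourier_bound {d : ℕ} (g : V d → ℂ) (ξ : V d) : ‖𝓕 g ξ‖ ≤ ∫ x, ‖g x‖ :=
  VectorFourier.norm_fourierIntegral_le_integral_norm _ _ _ _ _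

lemma fourier_flip {d : ℕ} {g φ : V d → ℂ} (hg : Integrable g) (hφ : Integrable φ) :
    ∫ ξ, 𝓕 g ξ * φ ξ = ∫ x, g x * 𝓕 φ x := by
  have := VectorFourier.integral_fourierIntegral_smul_eq_flip (μ := volume) (ν := volume)
    (L := innerₗ (V d)) (f := g) (g := φ) Real.continuous_fourierChar
    (by exact continuous_inner) hg hφ
  simp only [flip_innerₗ, smul_eq_mul] at this
  exact this

lemma fourier_pair_bound {d : ℕ} {g φ : V d → ℂ} (hg : Integrable g) (hφ : Integrable φ)
    {M : ℝ} (hM : ∀ x, ‖𝓕 φ x‖ ≤ M) : ‖∫ ξ, 𝓕 g ξ * φ ξ‖ ≤ (∫ x, ‖g x‖) * M := by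
  rw [fourier_flip hg hφ]
  calc ‖∫ x, g x * 𝓕 φ x‖ ≤ ∫ x, ‖g x‖ * M := by
        apply norm_integral_le_of_norm_le (hg.norm.mul_const M)
        filter_upwards with x
        rw [norm_mul]
        exact mul_le_mul_of_nonneg_left (hM x) (norm_nonneg _)
    _ = _ := integral_mul_const _ _

lemma plancherel_le {d : ℕ} {g : V d → ℂ} (hg : Integrable g) (hg2 : MemLp g 2) :
    MemLp (𝓕 g) 2 ∧ eLpNorm (𝓕 g) 2 volume = eLpNorm g 2 volume := by
  set G : Lp (α := V d) ℂ 2 volume := hg2.toLp g with hG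
  have hae : ∀ᵐ x, (𝓕 G : Lp (α := V d) ℂ 2 volume) x = 𝓕 g x := by
    apply ae_eq_of_integral_contDiff_smul_eq
    · exact (Lp.memLp _).locallyIntegrable (by norm_num)
    · exact (fourier_cont hg).locallyIntegrable
    intro φ hφ hφc
    have h1 : HasCompactSupport (Complex.ofRealCLM ∘ φ) := hφc.comp_left rfl
    have h2 : ContDiff ℝ (⊤ : ℕ∞) (Complex.ofRealCLM ∘ φ) := by fun_prop
    set ψ : 𝓢(V d, ℂ) := h1.toSchwartzMap h2 with hψ
    have hψx : ∀ x, ψ x = (φ x : ℂ) := fun x => rfl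
    have e1 := congrArg (fun T => T ψ) (Lp.fourier_toTemperedDistribution_eq G)
    simp only [Lp.toTemperedDistribution_apply, TemperedDistribution.fourier_apply] at e1
    have e2 : ∫ x, (𝓕 ψ) x • G x = ∫ x, 𝓕 (ψ : V d → ℂ) x * g x := by
      apply integral_congr_ae
      filter_upwards [hg2.coeFn_toLp] with x hx
      rw [hG, hx, smul_eq_mul]; rfl
    rw [e2, fourier_flip ψ.integrable hg] at e1
    simp only [smul_eq_mul, hψx] at e1
    simp only [Complex.real_smul]
    exact e1.symm
  have hae' : (𝓕 G : Lp (α := V d) ℂ 2 volume) =ᵐ[volume] 𝓕 g := hae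
  refine ⟨(Lp.memLp _).ae_eq hae', ?_⟩
  rw [← eLpNorm_congr_ae hae', ← eLpNorm_congr_ae hg2.coeFn_toLp]
  have := Lp.norm_fourier_eq G
  rw [Lp.norm_def, Lp.norm_def] at this
  exact (ENNReal.toReal_eq_toReal_iff' (Lp.eLpNorm_ne_top _) (Lp.eLpNorm_ne_top _)).1 this

lemma plancherel_int {d : ℕ} {g : V d → ℂ} (hg : Integrable g) (hg2 : MemLp g 2) :
    Integrable (fun ξ => ‖𝓕 g ξ‖ ^ 2) ∧ ∫ ξ, ‖𝓕 g ξ‖ ^ 2 = ∫ x, ‖g x‖ ^ 2 := by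
  obtain ⟨h1, h2⟩ := plancherel_le hg hg2
  refine ⟨h1.integrable_norm_pow (by norm_num), ?_⟩
  have h3 := h1.eLpNorm_eq_integral_rpow_norm (by norm_num) (by norm_num)
  have h4 := hg2.eLpNorm_eq_integral_rpow_norm (by norm_num) (by norm_num)
  rw [h3, h4] at h2
  simp only [ENNReal.toReal_ofNat, rpow_ofNat] at h2
  have p1 : 0 ≤ ∫ ξ, ‖𝓕 g ξ‖ ^ 2 := integral_nonneg fun _ => by positivity
  have p2 : 0 ≤ ∫ ξ, ‖g ξ‖ ^ 2 := integral_nonneg fun _ => by positivity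
  rw [ENNReal.ofReal_eq_ofReal_iff (by positivity) (by positivity)] at h2
  exact (Real.rpow_left_inj p1 p2 (by norm_num)).1 h2

lemma gauss_integrable {d : ℕ} {b : Fin d → ℂ} (hb : ∀ i, 0 < (b i).re) (c : Fin d → ℂ) :
    Integrable (fun ξ : V d => cexp (-∑ i, b i * (ξ i : ℂ) ^ 2 + ∑ i, c i * ξ i)) := by
  rw [← (PiLp.volume_preserving_toLp (Fin d)).integrable_comp_emb
    (MeasurableEquiv.toLp 2 _).measurableEmbedding]
  exact GaussianFourier.integrable_cexp_neg_sum_mul_add hb c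

lemma gauss_bound {d : ℕ} {b : Fin d → ℂ} (hb : ∀ i, 0 < (b i).re) (c : Fin d → ℝ) :
    ‖∫ ξ : V d, cexp (-∑ i, b i * (ξ i : ℂ) ^ 2 + ∑ i, (I * c i) * ξ i)‖
      ≤ ∏ i, (π / ‖b i‖) ^ (1 / 2 : ℝ) := by
  have h := GaussianFourier.integral_cexp_neg_sum_mul_add hb (fun i => I * c i)
  rw [← (PiLp.volume_preserving_toLp (Fin d)).integral_comp
    (MeasurableEquiv.toLp 2 _).measurableEmbedding]
  simp only []
  rw [h, norm_prod]
  apply Finset.prod_le_prod (fun _ _ => norm_nonneg _)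
  intro i _
  have hbi : b i ≠ 0 := fun h0 => by have := hb i; simp [h0] at this
  rw [norm_mul]
  have e1 : ‖((π : ℂ) / b i) ^ (1 / 2 : ℂ)‖ = (π / ‖b i‖) ^ (1 / 2 : ℝ) := by
    have h2 : ((1 / 2 : ℂ)) = ((1 / 2 : ℝ) : ℂ) := by push_cast; rfl
    rw [h2, Complex.norm_cpow_real]
    simp [abs_of_pos pi_pos]
  rw [e1]
  refine mul_le_of_le_one_right (by positivity) ?_
  rw [Complex.norm_exp, Real.exp_le_one_iff]
  have e2 : (I * (c i : ℂ)) ^ 2 / (4 * b i) = ((-(c i ^ 2 / 4) : ℝ) : ℂ) * (b i)⁻¹ := by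
    push_cast
    rw [mul_pow, I_sq]
    field_simp
  rw [e2, Complex.re_ofReal_mul, Complex.inv_re]
  have : 0 ≤ (b i).re / normSq (b i) := div_nonneg (hb i).le (normSq_nonneg _)
  nlinarith [sq_nonneg (c i)]


/-- The symbol of the wave operator (with general signs). -/
noncomputable def mm {d : ℕ} (η : Fin d → ℝ) (ξ : V d) : ℝ := 4 * π ^ 2 * ∑ i, η i * ξ i ^ 2

lemma mm_cont {d : ℕ} (η : Fin d → ℝ) : Continuous (mm η) := by
  unfold mm; fun_prop

noncomputable def gam {d : ℕ} (b : Fin d → ℂ) (ξ : V d) : ℂ := cexp (-∑ i, b i * (ξ i : ℂ) ^ 2)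

lemma gam_int {d : ℕ} {b : Fin d → ℂ} (hb : ∀ i, 0 < (b i).re) : Integrable (gam b) := by
  have := gauss_integrable hb (fun _ => 0)
  have e : (gam b : V d → ℂ) = fun ξ : V d => cexp (-∑ i, b i * (ξ i : ℂ) ^ 2) := rfl
  rw [e]; simpa using this

lemma gam_cont {d : ℕ} (b : Fin d → ℂ) : Continuous (gam b) := by
  unfold gam; fun_prop

lemma gam_fourier_bound {d : ℕ} {b : Fin d → ℂ} (hb : ∀ i, 0 < (b i).re) (x y : V d) :
    ‖𝓕 (fun ξ : V d => conj ((𝐞 (-inner ℝ ξ x) : ℂ) * gam b ξ)) y‖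
      ≤ ∏ i, (π / ‖b i‖) ^ (1 / 2 : ℝ) := by
  have h := gauss_bound (b := fun i => conj (b i)) (by simpa using hb)
    (fun i => 2 * π * (x i - y i))
  simp only [RCLike.norm_conj] at h
  refine le_trans (le_of_eq ?_) h
  rw [Real.fourier_eq]
  congr 1
  apply integral_congr_ae
  filter_upwards with ξ
  simp only [gam, Circle.smul_def, smul_eq_mul, Real.fourierChar_apply, ← Complex.exp_conj,
    ← Complex.exp_add]
  congr 1
  rw [map_add]
  simp only [PiLp.inner_apply, RCLike.inner_apply, conj_trivial, map_neg, map_sum, map_mul, map_pow,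
    conj_ofReal, conj_I]
  push_cast
  simp only [Finset.mul_sum, Finset.sum_mul, ← Finset.sum_neg_distrib, ← Finset.sum_add_distrib]
  apply Finset.sum_congr rfl
  intro i _
  ring

lemma reg_bound {d : ℕ} {b : Fin d → ℂ} (hb : ∀ i, 0 < (b i).re) {g h : V d → ℂ}
    (hg : Integrable g) (hh : Integrable h) :
    ‖∫ ξ, 𝓕 g ξ * (conj (𝓕 h ξ) * gam b ξ)‖ ≤
      (∫ x, ‖g x‖) * ((∫ x, ‖h x‖) * ∏ i, (π / ‖b i‖) ^ (1 / 2 : ℝ)) := by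
  apply fourier_pair_bound hg
  · refine (gam_int hb).bdd_mul (c := ∫ x, ‖h x‖) ?_ ?_
    · exact (Complex.continuous_conj.comp (fourier_cont hh)).aestronglyMeasurable
    · filter_upwards with ξ
      simpa using fourier_bound h ξ
  intro x
  rw [Real.fourier_eq, ← RCLike.norm_conj, ← integral_conj]
  have key := fourier_pair_bound (φ := fun ξ : V d => conj ((𝐞 (-inner ℝ ξ x) : ℂ) * gam b ξ)) hh
    ?_ (gam_fourier_bound hb x)
  · refine le_trans (le_of_eq ?_) key
    congr 1
    apply integral_congr_ae
    filter_upwards with ξ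
    simp only [Circle.smul_def, smul_eq_mul, map_mul, Complex.conj_conj]
    ring
  · have h1 : Integrable (fun ξ : V d => ((𝐞 (-inner ℝ ξ x) : ℂ) * gam b ξ)) := by
      refine (gam_int hb).bdd_mul (c := 1) ?_ ?_
      · apply Continuous.aestronglyMeasurable
        have : Continuous fun ξ : V d => (𝐞 (-inner ℝ ξ x)) :=
          Real.continuous_fourierChar.comp (by fun_prop)
        exact continuous_subtype_val.comp this
      · filter_upwards with ξ
        exact (Circle.norm_coe _).le
    exact (Complex.conjCLE : ℂ →L[ℝ] ℂ).integrable_comp h1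

/-- The sesquilinear form of the free propagator. -/
noncomputable def BB {d : ℕ} (η : Fin d → ℝ) (g h : V d → ℂ) (s : ℝ) : ℂ :=
  ∫ ξ, 𝓕 g ξ * conj (𝓕 h ξ) * cexp (I * (s * mm η ξ : ℝ))

structure Good {d : ℕ} (g : V d → ℂ) (E : ℝ) : Prop where
  int : Integrable g
  mem : MemLp g 2
  l1 : ∫ x, ‖g x‖ ≤ E
  l2 : ∫ x, ‖g x‖ ^ 2 ≤ E

lemma Good.nonneg {d : ℕ} {g : V d → ℂ} {E : ℝ} (h : Good g E) : 0 ≤ E :=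
  le_trans (integral_nonneg fun _ => norm_nonneg _) h.l1

lemma cs_real {d : ℕ} {f g : V d → ℂ} (hf : MemLp f 2) (hg : MemLp g 2) :
    ∫ x, ‖f x‖ * ‖g x‖ ≤ √(∫ x, ‖f x‖ ^ 2) * √(∫ x, ‖g x‖ ^ 2) := by
  have h := integral_mul_le_Lp_mul_Lq_of_nonneg (μ := (volume : Measure (V d)))
    (f := fun x => ‖f x‖) (g := fun x => ‖g x‖) Real.HolderConjugate.two_two
    (by filter_upwards with x; exact norm_nonneg _)
    (by filter_upwards with x; exact norm_nonneg _) (by simpa using hf.norm) (by simpa using hg.norm)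
  simpa [Real.sqrt_eq_rpow] using h

lemma prod_int {d : ℕ} {f g : V d → ℂ} (hf : MemLp f 2) (hg : MemLp g 2) :
    Integrable (fun x => ‖f x‖ * ‖g x‖) := by
  exact hf.norm.integrable_mul hg.norm

lemma Good.fmem {d : ℕ} {g : V d → ℂ} {E : ℝ} (h : Good g E) : MemLp (𝓕 g) 2 :=
  (plancherel_le h.int h.mem).1

lemma Good.f2 {d : ℕ} {g : V d → ℂ} {E : ℝ} (h : Good g E) : ∫ x, ‖𝓕 g x‖ ^ 2 ≤ E := by
  rw [(plancherel_int h.int h.mem).2]; exact h.l2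

lemma BB_disp {d : ℕ} {η : Fin d → ℝ} (hη : ∀ i, |η i| = 1) {g h : V d → ℂ} {E F : ℝ}
    (hg : Good g E) (hh : Good h F) {s : ℝ} (hs : 0 < s) :
    ‖BB η g h s‖ ≤ E * F * s ^ (-(d / 2 : ℝ)) := by
  let b : ℕ → Fin d → ℂ := fun n i => ((1 / (n + 1) : ℝ) : ℂ) - I * ((s * (4 * π ^ 2 * η i) : ℝ) : ℂ)
  have hb : ∀ n i, 0 < (b n i).re := by
    intro n i
    simp only [b, sub_re, ofReal_re, mul_re, I_re, I_im, ofReal_im]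
    have : (0:ℝ) < 1 / (n + 1) := by positivity
    simpa using this
  have hbn : ∀ n i, π * s ≤ ‖b n i‖ := by
    intro n i
    have h1 := Complex.abs_im_le_norm (b n i)
    have h2 : (b n i).im = - (s * (4 * π ^ 2 * η i)) := by
      simp only [b, sub_im, ofReal_re, mul_im, I_re, I_im, ofReal_im]
      ring
    rw [h2, abs_neg, abs_mul, abs_mul, hη i, abs_of_pos hs, abs_of_pos (by positivity)] at h1
    have : π * s ≤ s * (4 * π ^ 2 * 1) := by nlinarith [pi_gt_three, mul_pos hs pi_pos]
    linarith
  have hprod : ∀ n, ∏ i, (π / ‖b n i‖) ^ (1 / 2 : ℝ) ≤ s ^ (-(d / 2 : ℝ)) := by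
    intro n
    calc ∏ i, (π / ‖b n i‖) ^ (1 / 2 : ℝ) ≤ ∏ i : Fin d, s ^ (-(1 / 2) : ℝ) := by
          apply Finset.prod_le_prod (fun _ _ => by positivity)
          intro i _
          rw [Real.rpow_neg hs.le, ← Real.inv_rpow hs.le]
          apply Real.rpow_le_rpow (by positivity) _ (by norm_num)
          rw [div_le_iff₀ (lt_of_lt_of_le (by positivity) (hbn n i)), inv_mul_eq_div,
            le_div_iff₀ hs]
          exact hbn n i
      _ = s ^ (-(d / 2 : ℝ)) := by
          rw [Finset.prod_const, Finset.card_univ, Fintype.card_fin, ← Real.rpow_natCast,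
            ← Real.rpow_mul hs.le]
          congr 1; ring
  have hbd : ∀ n, ‖∫ ξ, 𝓕 g ξ * (conj (𝓕 h ξ) * gam (b n) ξ)‖ ≤ E * F * s ^ (-(d / 2 : ℝ)) := by
    intro n
    refine (reg_bound (hb n) hg.int hh.int).trans ?_
    rw [mul_assoc]
    have := hg.nonneg
    have := hh.nonneg
    have p : 0 ≤ ∏ i, (π / ‖b n i‖) ^ (1 / 2 : ℝ) := Finset.prod_nonneg fun _ _ => by positivity
    have q : 0 ≤ ∫ x, ‖h x‖ := integral_nonneg fun _ => norm_nonneg _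
    exact mul_le_mul hg.l1 (mul_le_mul hh.l1 (hprod n) p hh.nonneg) (by positivity) hg.nonneg
  have hgam : ∀ n ξ, gam (b n) ξ =
      ((Real.exp (-(1 / (n + 1) * ∑ i, ξ i ^ 2)) : ℝ) : ℂ) * cexp (I * (s * mm η ξ : ℝ)) := by
    intro n ξ
    simp only [gam, b, mm]
    rw [Complex.ofReal_exp, ← Complex.exp_add]
    congr 1
    push_cast
    simp only [Finset.mul_sum, ← Finset.sum_neg_distrib, ← Finset.sum_add_distrib]
    apply Finset.sum_congr rfl
    intro i _
    ring
  have hlim : Filter.Tendsto (fun n => ∫ ξ, 𝓕 g ξ * (conj (𝓕 h ξ) * gam (b n) ξ)) Filter.atTop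
      (nhds (BB η g h s)) := by
    apply tendsto_integral_of_dominated_convergence (fun ξ => ‖𝓕 g ξ‖ * ‖𝓕 h ξ‖)
    · intro n
      exact ((fourier_cont hg.int).mul ((Complex.continuous_conj.comp (fourier_cont hh.int)).mul
        (gam_cont _))).aestronglyMeasurable
    · exact prod_int hg.fmem hh.fmem
    · intro n
      filter_upwards with ξ
      rw [norm_mul, norm_mul, RCLike.norm_conj, hgam, norm_mul, mul_comm I, Complex.norm_exp_ofReal_mul_I,
        mul_one, Complex.norm_real, Real.norm_eq_abs, Real.abs_exp]
      have : Real.exp (-(1 / (n + 1) * ∑ i, ξ i ^ 2)) ≤ 1 := by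
        rw [Real.exp_le_one_iff]
        have : 0 ≤ 1 / ((n:ℝ) + 1) * ∑ i, ξ i ^ 2 := by positivity
        linarith
      exact mul_le_mul_of_nonneg_left (mul_le_of_le_one_right (norm_nonneg _) this) (norm_nonneg _)
    · filter_upwards with ξ
      have t1 : Filter.Tendsto (fun n : ℕ => Real.exp (-(1 / ((n:ℝ) + 1) * ∑ i, ξ i ^ 2)))
          Filter.atTop (nhds 1) := by
        have := (tendsto_one_div_add_atTop_nhds_zero_nat (𝕜 := ℝ)).mul_const (∑ i, ξ i ^ 2)
        have := (Real.continuous_exp.tendsto _).comp this.neg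
        simpa [Function.comp_def] using this
      have t2 := ((Complex.continuous_ofReal.tendsto _).comp t1).const_mul (𝓕 g ξ * conj (𝓕 h ξ))
      have t3 := t2.mul_const (cexp (I * (s * mm η ξ : ℝ)))
      simp only [Complex.ofReal_one, mul_one] at t3
      refine t3.congr fun n => ?_
      rw [hgam]
      simp only [Function.comp]
      ring
  exact le_of_tendsto hlim.norm (Filter.Eventually.of_forall hbd)

lemma BB_l2 {d : ℕ} {η : Fin d → ℝ} {g h : V d → ℂ} {E F : ℝ}
    (hg : Good g E) (hh : Good h F) (s : ℝ) : ‖BB η g h s‖ ≤ √E * √F := by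
  calc ‖BB η g h s‖ ≤ ∫ ξ, ‖𝓕 g ξ‖ * ‖𝓕 h ξ‖ := by
        apply norm_integral_le_of_norm_le (prod_int hg.fmem hh.fmem)
        filter_upwards with ξ
        rw [norm_mul, norm_mul, RCLike.norm_conj, mul_comm I, Complex.norm_exp_ofReal_mul_I, mul_one]
    _ ≤ _ := cs_real hg.fmem hh.fmem
    _ ≤ _ := mul_le_mul (Real.sqrt_le_sqrt hg.f2) (Real.sqrt_le_sqrt hh.f2) (by positivity)
        (by positivity)


noncomputable def zz {d : ℕ} (η : Fin d → ℝ) (a : ℝ) (ξ : V d) : ℂ := -(a : ℂ) + I * (mm η ξ : ℂ)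

lemma zz_re {d : ℕ} (η : Fin d → ℝ) (a : ℝ) (ξ : V d) : (zz η a ξ).re = -a := by simp [zz]
lemma zz_im {d : ℕ} (η : Fin d → ℝ) (a : ℝ) (ξ : V d) : (zz η a ξ).im = mm η ξ := by simp [zz]

lemma zz_cont {d : ℕ} (η : Fin d → ℝ) (a : ℝ) : Continuous (zz η a) := by
  have := mm_cont η
  unfold zz; fun_prop

noncomputable def Ph {d : ℕ} (η : Fin d → ℝ) (a : ℝ) (S : Set ℝ) (ξ : V d) : ℂ :=
  ∫ s in S, cexp (zz η a ξ * s)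

lemma exp_zz {d : ℕ} (η : Fin d → ℝ) (a s : ℝ) (ξ : V d) :
    cexp (zz η a ξ * s) = (Real.exp (-(a * s)) : ℝ) * cexp (I * (s * mm η ξ : ℝ)) := by
  rw [Complex.ofReal_exp, ← Complex.exp_add]
  congr 1
  simp only [zz]; push_cast; ring

lemma norm_exp_zz {d : ℕ} (η : Fin d → ℝ) (a s : ℝ) (ξ : V d) :
    ‖cexp (zz η a ξ * s)‖ = Real.exp (-(a * s)) := by
  rw [Complex.norm_exp]; congr 1
  simp [zz_re]

lemma fub_integrable {d : ℕ} (η : Fin d → ℝ) {g h : V d → ℂ} {E F : ℝ}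
    (hg : Good g E) (hh : Good h F) {a : ℝ} (ha : 0 < a) {S : Set ℝ} (hS' : S ⊆ Set.Ioi 0) :
    Integrable (fun p : V d × ℝ => 𝓕 g p.1 * conj (𝓕 h p.1) * cexp (zz η a p.1 * p.2))
      ((volume : Measure (V d)).prod (volume.restrict S)) := by
  have h1 : Integrable (fun s => Real.exp (-a * s)) (volume.restrict S) :=
    (integrableOn_exp_mul_Ioi (a := -a) (by linarith) 0).mono_set hS'
  have h2 := (prod_int hg.fmem hh.fmem).mul_prod h1
  refine h2.mono ?_ ?_
  · apply Continuous.aestronglyMeasurable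
    have c1 := fourier_cont hg.int
    have c2 := fourier_cont hh.int
    have c3 := zz_cont η a
    have c4 : Continuous fun p : V d × ℝ => conj (𝓕 h p.1) :=
      Complex.continuous_conj.comp (c2.comp continuous_fst)
    have c5 : Continuous fun p : V d × ℝ => cexp (zz η a p.1 * p.2) := by fun_prop
    exact ((c1.comp continuous_fst).mul c4).mul c5
  · filter_upwards with p
    rw [norm_mul, norm_mul, RCLike.norm_conj, norm_exp_zz, norm_mul, norm_mul, norm_norm, norm_norm,
      Real.norm_eq_abs, Real.abs_exp, neg_mul]

lemma fub {d : ℕ} (η : Fin d → ℝ) {g h : V d → ℂ} {E F : ℝ}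
    (hg : Good g E) (hh : Good h F) {a : ℝ} (ha : 0 < a) {S : Set ℝ} (hS : MeasurableSet S)
    (hS' : S ⊆ Set.Ioi 0) {D : ℝ → ℝ} (hD : IntegrableOn D S)
    (hDb : ∀ s ∈ S, Real.exp (-(a * s)) * ‖BB η g h s‖ ≤ D s) :
    ‖∫ ξ, 𝓕 g ξ * conj (𝓕 h ξ) * Ph η a S ξ‖ ≤ ∫ s in S, D s := by
  have e : ∫ ξ, 𝓕 g ξ * conj (𝓕 h ξ) * Ph η a S ξ =
      ∫ s in S, ∫ ξ, 𝓕 g ξ * conj (𝓕 h ξ) * cexp (zz η a ξ * s) := by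
    rw [← integral_integral_swap (fub_integrable η hg hh ha hS')]
    apply integral_congr_ae
    filter_upwards with ξ
    simp only [Ph]
    rw [← integral_const_mul]
  rw [e]
  apply norm_integral_le_of_norm_le hD
  rw [ae_restrict_iff' hS]
  filter_upwards with s hs
  refine le_trans (le_of_eq ?_) (hDb s hs)
  have : ∫ ξ, 𝓕 g ξ * conj (𝓕 h ξ) * cexp (zz η a ξ * s) =
      (Real.exp (-(a * s)) : ℝ) * BB η g h s := by
    rw [BB, ← integral_const_mul]
    apply integral_congr_ae
    filter_upwards with ξ
    rw [exp_zz]; ring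
  rw [this, norm_mul, Complex.norm_real, Real.norm_eq_abs, Real.abs_exp]

lemma Ph_Ioi {d : ℕ} (η : Fin d → ℝ) {a : ℝ} (ha : 0 < a) (σ : ℝ) (ξ : V d) :
    Ph η a (Set.Ioi σ) ξ = -cexp (zz η a ξ * σ) / zz η a ξ :=
  integral_exp_mul_complex_Ioi (by rw [zz_re]; linarith) σ

lemma Ph_Ioi_zero {d : ℕ} (η : Fin d → ℝ) {a : ℝ} (ha : 0 < a) (ξ : V d) :
    Ph η a (Set.Ioi 0) ξ = -1 / zz η a ξ := by
  rw [Ph_Ioi η ha]; simp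

lemma Ph_split {d : ℕ} (η : Fin d → ℝ) {a : ℝ} (ha : 0 < a) {σ : ℝ} (hσ : 0 < σ) (ξ : V d) :
    Ph η a (Set.Ioi 0) ξ = Ph η a (Set.Ioc 0 σ) ξ + Ph η a (Set.Ioi σ) ξ := by
  have hi := integrableOn_exp_mul_complex_Ioi (a := zz η a ξ) (by rw [zz_re]; linarith) 0
  unfold Ph
  rw [← setIntegral_union (by simp) measurableSet_Ioi
    (hi.mono_set Set.Ioc_subset_Ioi_self) (hi.mono_set (Set.Ioi_subset_Ioi hσ.le)),
    Set.Ioc_union_Ioi_eq_Ioi hσ.le]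

lemma norm_zz_sq {d : ℕ} (η : Fin d → ℝ) (a : ℝ) (ξ : V d) :
    ‖zz η a ξ‖ ^ 2 = a ^ 2 + mm η ξ ^ 2 := by
  rw [← Complex.normSq_eq_norm_sq, Complex.normSq_apply, zz_re, zz_im]; ring

lemma zz_ne {d : ℕ} (η : Fin d → ℝ) {a : ℝ} (ha : 0 < a) (ξ : V d) : zz η a ξ ≠ 0 := by
  intro h
  have := zz_re η a ξ
  rw [h] at this
  simp at this; linarith

lemma Ph_cont_Ioi {d : ℕ} (η : Fin d → ℝ) {a : ℝ} (ha : 0 < a) (σ : ℝ) :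
    Continuous (Ph η a (Set.Ioi σ)) := by
  rw [show Ph η a (Set.Ioi σ) = fun ξ => -cexp (zz η a ξ * σ) / zz η a ξ from
    funext (Ph_Ioi η ha σ)]
  have := zz_cont η a
  exact Continuous.div (by fun_prop) this (zz_ne η ha)

lemma Ph_cont_Ioc {d : ℕ} (η : Fin d → ℝ) {a : ℝ} (ha : 0 < a) {σ : ℝ} (hσ : 0 < σ) :
    Continuous (Ph η a (Set.Ioc 0 σ)) := by
  rw [show Ph η a (Set.Ioc 0 σ) = fun ξ => Ph η a (Set.Ioi 0) ξ - Ph η a (Set.Ioi σ) ξ from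
    funext fun ξ => by rw [Ph_split η ha hσ]; ring]
  exact (Ph_cont_Ioi η ha 0).sub (Ph_cont_Ioi η ha σ)

lemma Ph_Ioi_bound {d : ℕ} (η : Fin d → ℝ) {a : ℝ} (ha : 0 < a) {σ : ℝ} (hσ : 0 ≤ σ) (ξ : V d) :
    ‖Ph η a (Set.Ioi σ) ξ‖ ≤ 1 / ‖zz η a ξ‖ := by
  rw [Ph_Ioi η ha, norm_div, norm_neg, norm_exp_zz]
  gcongr
  rw [Real.exp_le_one_iff]
  have := mul_nonneg ha.le hσ
  linarith

lemma Ph_Ioc_le {d : ℕ} (η : Fin d → ℝ) {a : ℝ} (ha : 0 < a) {σ : ℝ} (hσ : 0 < σ) (ξ : V d) :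
    ‖Ph η a (Set.Ioc 0 σ) ξ‖ ≤ σ := by
  unfold Ph
  have := norm_setIntegral_le_of_norm_le_const (μ := (volume : Measure ℝ)) (s := Set.Ioc 0 σ)
    (f := fun s : ℝ => cexp (zz η a ξ * s)) (C := 1) (by simp) (fun s hs => by
      rw [norm_exp_zz, Real.exp_le_one_iff]
      have := mul_nonneg ha.le hs.1.le
      linarith)
  simpa [Measure.real, hσ.le] using this

lemma Ph_Ioc_sq {d : ℕ} (η : Fin d → ℝ) {a : ℝ} (ha : 0 < a) {σ : ℝ} (hσ : 0 < σ) (ξ : V d) :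
    ‖Ph η a (Set.Ioc 0 σ) ξ‖ ^ 2 ≤ 5 * (σ * (σ⁻¹ / (σ⁻¹ ^ 2 + mm η ξ ^ 2))) := by
  have h1 := Ph_Ioc_le η ha hσ ξ
  have h2 : ‖Ph η a (Set.Ioc 0 σ) ξ‖ ≤ 2 / ‖zz η a ξ‖ := by
    have e : Ph η a (Set.Ioc 0 σ) ξ = Ph η a (Set.Ioi 0) ξ - Ph η a (Set.Ioi σ) ξ := by
      rw [Ph_split η ha hσ]; ring
    rw [e]
    refine (norm_sub_le _ _).trans ?_
    have := Ph_Ioi_bound η ha le_rfl ξ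
    have := Ph_Ioi_bound η ha hσ.le ξ
    calc _ ≤ 1 / ‖zz η a ξ‖ + 1 / ‖zz η a ξ‖ := by linarith
      _ = _ := by ring
  set P := ‖Ph η a (Set.Ioc 0 σ) ξ‖
  have hP : 0 ≤ P := norm_nonneg _
  have hz : 0 < ‖zz η a ξ‖ := norm_pos_iff.2 (zz_ne η ha ξ)
  have hzz := norm_zz_sq η a ξ
  rw [le_div_iff₀ hz] at h2
  have h3 : P ^ 2 * ‖zz η a ξ‖ ^ 2 ≤ 4 := by
    rw [← mul_pow]; nlinarith [mul_nonneg hP hz.le]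
  have h4 : (P * σ⁻¹) ^ 2 ≤ 1 := by
    have : P * σ⁻¹ ≤ 1 := by rw [← div_eq_mul_inv, div_le_one hσ]; exact h1
    have : 0 ≤ P * σ⁻¹ := by positivity
    nlinarith
  have h5 : 5 * (σ * (σ⁻¹ / (σ⁻¹ ^ 2 + mm η ξ ^ 2))) = 5 / (σ⁻¹ ^ 2 + mm η ξ ^ 2) := by
    have : 0 < σ⁻¹ ^ 2 + mm η ξ ^ 2 := by positivity
    field_simp
  rw [h5, le_div_iff₀ (by positivity)]
  rw [hzz] at h3
  rw [mul_pow] at h4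
  nlinarith [mul_nonneg (sq_nonneg P) (sq_nonneg a)]

/-- The resolvent form. -/
noncomputable def RR {d : ℕ} (η : Fin d → ℝ) (a : ℝ) (g h : V d → ℂ) : ℂ :=
  ∫ ξ, 𝓕 g ξ * conj (𝓕 h ξ) * Ph η a (Set.Ioi 0) ξ

noncomputable def QQ {d : ℕ} (η : Fin d → ℝ) (a : ℝ) (g : V d → ℂ) : ℝ :=
  ∫ ξ, ‖𝓕 g ξ‖ ^ 2 * (a / (a ^ 2 + mm η ξ ^ 2))

lemma w_int {d : ℕ} {g h : V d → ℂ} {E F : ℝ}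
    (hg : Good g E) (hh : Good h F) {W : V d → ℂ} (hW : Continuous W) {c : ℝ}
    (hWc : ∀ ξ, ‖W ξ‖ ≤ c) :
    Integrable (fun ξ => 𝓕 g ξ * conj (𝓕 h ξ) * W ξ) := by
  refine ((prod_int hg.fmem hh.fmem).mul_const c).mono' ?_ ?_
  · exact (((fourier_cont hg.int).mul (Complex.continuous_conj.comp (fourier_cont hh.int))).mul
      hW).aestronglyMeasurable
  · filter_upwards with ξ
    rw [norm_mul, norm_mul, RCLike.norm_conj]
    exact mul_le_mul_of_nonneg_left (hWc ξ) (by positivity)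

lemma Ph_Ioi_bound' {d : ℕ} (η : Fin d → ℝ) {a : ℝ} (ha : 0 < a) {σ : ℝ} (hσ : 0 ≤ σ) (ξ : V d) :
    ‖Ph η a (Set.Ioi σ) ξ‖ ≤ 1 / a := by
  refine (Ph_Ioi_bound η ha hσ ξ).trans ?_
  have := Complex.abs_re_le_norm (zz η a ξ)
  rw [zz_re, abs_neg, abs_of_pos ha] at this
  gcongr

lemma RR_split {d : ℕ} (η : Fin d → ℝ) {g h : V d → ℂ} {E F : ℝ}
    (hg : Good g E) (hh : Good h F) {a : ℝ} (ha : 0 < a) {σ : ℝ} (hσ : 0 < σ) :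
    RR η a g h = (∫ ξ, 𝓕 g ξ * conj (𝓕 h ξ) * Ph η a (Set.Ioc 0 σ) ξ) +
      ∫ ξ, 𝓕 g ξ * conj (𝓕 h ξ) * Ph η a (Set.Ioi σ) ξ := by
  rw [RR, ← integral_add (w_int hg hh (Ph_cont_Ioc η ha hσ) (Ph_Ioc_le η ha hσ))
    (w_int hg hh (Ph_cont_Ioi η ha σ) (Ph_Ioi_bound' η ha hσ.le))]
  apply integral_congr_ae
  filter_upwards with ξ
  rw [Ph_split η ha hσ]; ring

lemma RR_re {d : ℕ} (η : Fin d → ℝ) {g : V d → ℂ} {E : ℝ}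
    (hg : Good g E) {a : ℝ} (ha : 0 < a) : QQ η a g = (RR η a g g).re := by
  have h := integral_re (w_int hg hg (Ph_cont_Ioi η ha 0) (Ph_Ioi_bound' η ha le_rfl))
  simp only [RCLike.re_to_complex] at h
  rw [RR, ← h, QQ]
  apply integral_congr_ae
  filter_upwards with ξ
  rw [Complex.mul_conj, Complex.re_ofReal_mul, Complex.normSq_eq_norm_sq, Ph_Ioi_zero η ha,
    neg_div, Complex.neg_re, one_div, Complex.inv_re, zz_re, Complex.normSq_eq_norm_sq, norm_zz_sq]
  ring

lemma QQ_int {d : ℕ} (η : Fin d → ℝ) {g : V d → ℂ} {E : ℝ}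
    (hg : Good g E) {a : ℝ} (ha : 0 < a) :
    Integrable (fun ξ => ‖𝓕 g ξ‖ ^ 2 * (a / (a ^ 2 + mm η ξ ^ 2))) := by
  have h := (w_int hg hg (Ph_cont_Ioi η ha 0) (Ph_Ioi_bound' η ha le_rfl)).re
  refine h.congr ?_
  filter_upwards with ξ
  simp only [RCLike.re_to_complex]
  rw [Complex.mul_conj, Complex.re_ofReal_mul, Complex.normSq_eq_norm_sq, Ph_Ioi_zero η ha,
    neg_div, Complex.neg_re, one_div, Complex.inv_re, zz_re, Complex.normSq_eq_norm_sq, norm_zz_sq]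
  ring

lemma QQ_nonneg {d : ℕ} (η : Fin d → ℝ) (g : V d → ℂ) {a : ℝ} (ha : 0 < a) : 0 ≤ QQ η a g :=
  integral_nonneg fun ξ => by positivity

/-- Cauchy-Schwarz with a weight on one side. -/
lemma w_cs {d : ℕ} (η : Fin d → ℝ) {g h : V d → ℂ} {E F : ℝ}
    (hg : Good g E) (hh : Good h F) {W : V d → ℂ} (hW : Continuous W) {c : ℝ} {a K : ℝ} (ha : 0 < a)
    (hWc : ∀ ξ, ‖W ξ‖ ≤ c) (hK : 0 ≤ K)
    (hWa : ∀ ξ, ‖W ξ‖ ^ 2 ≤ K * (a / (a ^ 2 + mm η ξ ^ 2))) :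
    ‖∫ ξ, 𝓕 g ξ * conj (𝓕 h ξ) * W ξ‖ ≤ √(K * QQ η a g) * √F := by
  have hm : MemLp (fun ξ => 𝓕 g ξ * W ξ) 2 := by
    have := hg.fmem.norm.mul_const c
    refine this.mono ((fourier_cont hg.int).mul hW).aestronglyMeasurable ?_
    filter_upwards with ξ
    rw [norm_mul, norm_mul, norm_norm]
    exact mul_le_mul_of_nonneg_left ((hWc ξ).trans (le_abs_self c)) (norm_nonneg _)
  calc ‖∫ ξ, 𝓕 g ξ * conj (𝓕 h ξ) * W ξ‖ ≤ ∫ ξ, ‖𝓕 g ξ * W ξ‖ * ‖𝓕 h ξ‖ := by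
        apply norm_integral_le_of_norm_le (prod_int hm hh.fmem)
        filter_upwards with ξ
        rw [norm_mul, norm_mul, norm_mul, RCLike.norm_conj]
        exact le_of_eq (by ring)
    _ ≤ √(∫ ξ, ‖𝓕 g ξ * W ξ‖ ^ 2) * √(∫ ξ, ‖𝓕 h ξ‖ ^ 2) := cs_real hm hh.fmem
    _ ≤ _ := by
        refine mul_le_mul (Real.sqrt_le_sqrt ?_) (Real.sqrt_le_sqrt hh.f2) (by positivity)
          (by positivity)
        rw [QQ, ← integral_const_mul]
        apply integral_mono (hm.integrable_norm_pow (by norm_num))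
          ((QQ_int η hg ha).const_mul K)
        intro ξ
        simp only [norm_mul, mul_pow]
        have := mul_le_mul_of_nonneg_left (hWa ξ) (sq_nonneg ‖𝓕 g ξ‖)
        calc _ ≤ _ := this
          _ = _ := by ring


lemma interp {x A B θ : ℝ} (hx : 0 ≤ x) (hA : x ≤ A) (hB : x ≤ B) (h0 : 0 ≤ θ) (h1 : θ ≤ 1) :
    x ≤ A ^ θ * B ^ (1 - θ) := by
  rcases hx.eq_or_lt with rfl | hx'
  · have := hA; have := hB; positivity
  calc x = x ^ θ * x ^ (1 - θ) := by rw [← Real.rpow_add hx']; simp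
    _ ≤ A ^ θ * B ^ (1 - θ) := by
        have : 0 ≤ A := hx.trans hA
        have : 0 ≤ 1 - θ := by linarith
        gcongr

lemma RR_zero_left {d : ℕ} (η : Fin d → ℝ) (a : ℝ) {g h : V d → ℂ} (hg : Good g 0) : RR η a g h = 0 := by
  have : ∀ ξ, 𝓕 g ξ = 0 := fun ξ => by
    have := (fourier_bound g ξ).trans hg.l1
    simpa using this
  simp [RR, this]

lemma RR_zero_right {d : ℕ} (η : Fin d → ℝ) (a : ℝ) {g h : V d → ℂ} (hh : Good h 0) : RR η a g h = 0 := by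
  have : ∀ ξ, 𝓕 h ξ = 0 := fun ξ => by
    have := (fourier_bound h ξ).trans hh.l1
    simpa using this
  simp [RR, this]

/-- balanced bound, non-endpoint -/
lemma Q1 {d : ℕ} (hd : 2 ≤ d) {γ : ℝ} (h0 : 0 < γ) (h1 : γ < 1) {η : Fin d → ℝ} (hη : ∀ i, |η i| = 1)
    {g h : V d → ℂ} {E F : ℝ} (hg : Good g E) (hh : Good h F) (hE : 0 < E) (hF : 0 < F)
    {a : ℝ} (ha : 0 < a) :
    ‖RR η a g h‖ ≤ Real.Gamma (1 - γ) * a ^ (γ - 1) * (E * F) ^ (1 / 2 + γ / d) := by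
  have hd' : (2 : ℝ) ≤ d := by exact_mod_cast hd
  have hi : IntegrableOn (fun s : ℝ => s ^ (-γ) * Real.exp (-a * s)) (Set.Ioi 0) := by
    simpa using integrableOn_rpow_mul_exp_neg_mul_rpow (p := 1) (s := -γ) (b := a) (by linarith) one_pos ha
  have hb := fub η hg hh ha measurableSet_Ioi le_rfl
    (D := fun s => (E * F) ^ (1 / 2 + γ / d) * (s ^ (-γ) * Real.exp (-a * s))) (hi.const_mul _) (by
      intro s hs
      have hs : 0 < s := hs
      have h2 : ‖BB η g h s‖ ≤ (E * F) ^ (1 / 2 + γ / d) * s ^ (-γ) := by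
        have := interp (norm_nonneg _) (BB_disp hη hg hh hs) (BB_l2 (η := η) hg hh s)
          (θ := 2 * γ / d) (by positivity) (by rw [div_le_one (by linarith)]; linarith)
        refine this.trans (le_of_eq ?_)
        rw [← Real.sqrt_mul hE.le, Real.sqrt_eq_rpow, Real.mul_rpow (by positivity) (by positivity),
          ← Real.rpow_mul (by positivity), ← Real.rpow_mul (by positivity), mul_right_comm,
          ← Real.rpow_add (by positivity)]
        congr 2
        · field_simp; ring
        · field_simp
      calc _ ≤ Real.exp (-(a * s)) * ((E * F) ^ (1 / 2 + γ / d) * s ^ (-γ)) := by gcongr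
        _ = _ := by rw [neg_mul]; ring)
  refine hb.trans (le_of_eq ?_)
  rw [integral_const_mul]
  have := Real.integral_rpow_mul_exp_neg_mul_Ioi (a := 1 - γ) (r := a) (by linarith) ha
  simp only [sub_sub_cancel_left, neg_mul] at this ⊢
  rw [this, one_div a, Real.inv_rpow ha.le, ← Real.rpow_neg ha.le]
  rw [neg_sub]; ring

lemma RR_cs {d : ℕ} (η : Fin d → ℝ)
    {g h : V d → ℂ} {E F : ℝ} (hg : Good g E) (hh : Good h F) {a : ℝ} (ha : 0 < a) :
    ‖RR η a g h‖ ≤ √(a⁻¹ * QQ η a g) * √F := by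
  refine w_cs η hg hh (Ph_cont_Ioi η ha 0) ha (Ph_Ioi_bound' η ha le_rfl) (by positivity) ?_
  intro ξ
  rw [Ph_Ioi_zero η ha, norm_div, div_pow, norm_zz_sq]
  simp
  field_simp
  rfl

lemma QQ_le {d : ℕ} (η : Fin d → ℝ) {g : V d → ℂ} {E : ℝ} (hg : Good g E) {a : ℝ} (ha : 0 < a) :
    QQ η a g ≤ ‖RR η a g g‖ := by
  rw [RR_re η hg ha]; exact (le_abs_self _).trans (Complex.abs_re_le_norm _)

lemma Q4 {d : ℕ} (hd : 2 ≤ d) {γ : ℝ} (h0 : 0 < γ) (h1 : γ < 1) :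
    ∃ C A B : ℝ, 0 ≤ C ∧ 0 < B ∧ B < A ∧ A + B = 1 + 2 * γ / d ∧
    ∀ {η : Fin d → ℝ}, (∀ i, |η i| = 1) → ∀ {g h : V d → ℂ} {E F : ℝ}, Good g E → Good h F →
     0 < E → 0 < F → ∀ {a : ℝ}, 0 < a → ‖RR η a g h‖ ≤ C * a ^ (γ - 1) * E ^ A * F ^ B := by
  have hd' : (2 : ℝ) ≤ d := by exact_mod_cast hd
  set p : ℝ := 2 * γ / (1 + γ) with hp
  have hp0 : 0 < p := by positivity
  have hp1 : p < 1 := by rw [hp, div_lt_one (by linarith)]; linarith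
  have hpγ : p * (1 + γ) = 2 * γ := by rw [hp]; field_simp
  set G := Real.Gamma (1 - p) with hG
  have hGp : 0 < G := Real.Gamma_pos_of_pos (by linarith)
  refine ⟨G ^ ((1 - γ) / 2 + γ), 1 / 2 + p / d, 1 / 2 + γ * p / d, by positivity, by positivity, ?_, ?_, ?_⟩
  · gcongr
    nlinarith
  · field_simp; linarith
  intro η hη g h E F hg hh hE hF a ha
  have hx := Q1 hd hp0 hp1 hη hg hh hE hF ha
  have hy : ‖RR η a g h‖ ≤ √(a⁻¹ * (G * a ^ (p - 1) * (E * E) ^ (1 / 2 + p / d))) * √F := by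
    refine (RR_cs η hg hh ha).trans ?_
    gcongr
    exact (QQ_le η hg ha).trans (Q1 hd hp0 hp1 hη hg hg hE hE ha)
  have := interp (norm_nonneg _) hy hx (θ := 1 - γ) (by linarith) (by linarith)
  refine this.trans (le_of_eq ?_)
  rw [← hG]
  obtain ⟨e, rfl⟩ : ∃ e, Real.exp e = E := ⟨_, Real.exp_log hE⟩
  obtain ⟨f, rfl⟩ : ∃ e, Real.exp e = F := ⟨_, Real.exp_log hF⟩
  obtain ⟨b, rfl⟩ : ∃ e, Real.exp e = a := ⟨_, Real.exp_log ha⟩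
  obtain ⟨k, hk⟩ : ∃ e, Real.exp e = G := ⟨_, Real.exp_log hGp⟩
  rw [← hk]
  simp only [Real.sqrt_eq_rpow, ← Real.exp_mul, ← Real.exp_add, ← Real.exp_neg]
  congr 1
  clear_value p
  have hd0 : (d : ℝ) ≠ 0 := by positivity
  field_simp
  ring_nf
  linear_combination (2 * b * d) * hpγ

lemma tail_bd {d : ℕ} (hd : 3 ≤ d) {η : Fin d → ℝ} (hη : ∀ i, |η i| = 1)
    {g h : V d → ℂ} {E F : ℝ} (hg : Good g E) (hh : Good h F) {a : ℝ} (ha : 0 < a) {σ : ℝ} (hσ : 0 < σ) :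
    ‖∫ ξ, 𝓕 g ξ * conj (𝓕 h ξ) * Ph η a (Set.Ioi σ) ξ‖ ≤
      E * F * σ ^ (1 - (d / 2 : ℝ)) * (2 / (d - 2)) := by
  have hd' : (3 : ℝ) ≤ d := by exact_mod_cast hd
  have h1 : (-(d / 2 : ℝ)) < -1 := by linarith
  have hb := fub η hg hh ha (S := Set.Ioi σ) measurableSet_Ioi (Set.Ioi_subset_Ioi hσ.le)
    (D := fun s => E * F * s ^ (-(d / 2 : ℝ))) ((integrableOn_Ioi_rpow_of_lt h1 hσ).const_mul _) (by
      intro s hs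
      have hs : 0 < s := hσ.trans hs
      have h2 : Real.exp (-(a * s)) ≤ 1 := by
        rw [Real.exp_le_one_iff]; have := mul_pos ha hs; linarith
      calc _ ≤ 1 * ‖BB η g h s‖ := by gcongr
        _ ≤ _ := by rw [one_mul]; exact BB_disp hη hg hh hs)
  refine hb.trans (le_of_eq ?_)
  rw [integral_const_mul, integral_Ioi_rpow_of_lt h1 hσ, mul_assoc (E * F), neg_add_eq_sub]
  congr 1
  rw [neg_div, ← div_neg, div_eq_mul_inv]
  congr 1
  rw [inv_eq_iff_eq_inv, inv_div]; ring

lemma Q2 {d : ℕ} (hd : 3 ≤ d) {η : Fin d → ℝ} (hη : ∀ i, |η i| = 1)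
    {g : V d → ℂ} {E : ℝ} (hg : Good g E) (hE : 0 < E) {a : ℝ} (ha : 0 < a) :
    QQ η a g ≤ (1 + 2 / (d - 2)) * E ^ (1 + 2 / d : ℝ) := by
  have hd' : (3 : ℝ) ≤ d := by exact_mod_cast hd
  refine (QQ_le η hg ha).trans ?_
  have hσ : 0 < E ^ (2 / d : ℝ) := by positivity
  rw [RR_split η hg hg ha hσ]
  refine (norm_add_le _ _).trans ?_
  have h1 := tail_bd hd hη hg hg ha hσ
  have h2 : ‖∫ ξ, 𝓕 g ξ * conj (𝓕 g ξ) * Ph η a (Set.Ioc 0 (E ^ (2 / d : ℝ))) ξ‖ ≤ E * E ^ (2 / d : ℝ) := by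
    calc _ ≤ ∫ ξ, ‖𝓕 g ξ‖ * ‖𝓕 g ξ‖ * E ^ (2 / d : ℝ) := by
          refine norm_integral_le_of_norm_le ((prod_int hg.fmem hg.fmem).mul_const _) ?_
          filter_upwards with ξ
          rw [norm_mul, norm_mul, RCLike.norm_conj]
          gcongr
          exact Ph_Ioc_le η ha hσ ξ
      _ ≤ _ := by
          rw [integral_mul_const]
          gcongr
          simpa [sq] using hg.f2
  have e1 : E * E ^ (2 / d : ℝ) = E ^ (1 + 2 / d : ℝ) := by rw [Real.rpow_add hE, Real.rpow_one]
  have e2 : E * E * (E ^ (2 / d : ℝ)) ^ (1 - (d / 2 : ℝ)) = E ^ (1 + 2 / d : ℝ) := by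
    obtain ⟨e, rfl⟩ : ∃ e, Real.exp e = E := ⟨_, Real.exp_log hE⟩
    simp only [← Real.exp_mul, ← Real.exp_add]
    congr 1
    field_simp; ring
  rw [e2] at h1
  rw [e1] at h2
  calc _ ≤ _ := add_le_add h2 h1
    _ = _ := by ring

lemma Q3 {d : ℕ} (hd : 3 ≤ d) :
    ∃ C A B : ℝ, 0 ≤ C ∧ 0 < B ∧ B < A ∧ A + B = 1 + 2 * 1 / d ∧
    ∀ {η : Fin d → ℝ}, (∀ i, |η i| = 1) → ∀ {g h : V d → ℂ} {E F : ℝ}, Good g E → Good h F →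
     0 < E → 0 < F → ∀ {a : ℝ}, 0 < a → ‖RR η a g h‖ ≤ C * a ^ ((1 : ℝ) - 1) * E ^ A * F ^ B := by
  have hd' : (3 : ℝ) ≤ d := by exact_mod_cast hd
  have hd1 : (d : ℝ) - 1 ≠ 0 := by linarith
  have hd0 : (d : ℝ) ≠ 0 := by linarith
  set α : ℝ := 1 / (d - 1) with hα
  have hα0 : 0 < α := by rw [hα]; apply div_pos one_pos; linarith
  have hαd : α * d = 1 + α := by rw [hα]; field_simp; ring
  set K : ℝ := 1 + 2 / (d - 2) with hK
  have hK0 : 0 ≤ 2 / ((d : ℝ) - 2) := div_nonneg (by norm_num) (by linarith)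
  have hK1 : 0 < K := by linarith
  refine ⟨√(5 * K) + 2 / (d - 2), 1 / 2 + 2 / d - α / 2, 1 / 2 + α / 2, by positivity, by positivity, ?_, ?_, ?_⟩
  · have : α < 2 / d := by
      rw [hα, div_lt_div_iff₀ (by linarith) (by linarith)]; linarith
    linarith
  · ring
  intro η hη g h E F hg hh hE hF a ha
  set σ : ℝ := F ^ α * E ^ (2 / d - α) with hσd
  have hσ : 0 < σ := by positivity
  rw [RR_split η hg hh ha hσ]
  refine (norm_add_le _ _).trans ?_
  have h1 := tail_bd hd hη hg hh ha hσ
  have h2 := w_cs η hg hh (Ph_cont_Ioc η ha hσ) (K := 5 * σ) (inv_pos.2 hσ) (Ph_Ioc_le η ha hσ) (by positivity)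
    (fun ξ => by rw [mul_assoc]; exact Ph_Ioc_sq η ha hσ ξ)
  have h3 : √(5 * σ * QQ η σ⁻¹ g) * √F ≤ √(5 * σ * (K * E ^ (1 + 2 / d : ℝ))) * √F := by
    gcongr
    exact Q2 hd hη hg hE (inv_pos.2 hσ)
  have e1 : E * F * σ ^ (1 - (d / 2 : ℝ)) = E ^ (1 / 2 + 2 / d - α / 2) * F ^ (1 / 2 + α / 2) := by
    rw [hσd]
    clear_value α
    obtain ⟨e, rfl⟩ : ∃ e, Real.exp e = E := ⟨_, Real.exp_log hE⟩
    obtain ⟨f, rfl⟩ : ∃ e, Real.exp e = F := ⟨_, Real.exp_log hF⟩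
    simp only [← Real.exp_mul, ← Real.exp_add]
    congr 1
    field_simp
    linear_combination (-f * d + e * d) * hαd
  have e2 : √(5 * σ * (K * E ^ (1 + 2 / d : ℝ))) * √F =
      √(5 * K) * (E ^ (1 / 2 + 2 / d - α / 2) * F ^ (1 / 2 + α / 2)) := by
    rw [show 5 * σ * (K * E ^ (1 + 2 / d : ℝ)) = 5 * K * (σ * E ^ (1 + 2 / d : ℝ)) by ring,
      Real.sqrt_mul (by positivity), mul_assoc]
    congr 1
    rw [hσd]
    clear_value α
    obtain ⟨e, rfl⟩ : ∃ e, Real.exp e = E := ⟨_, Real.exp_log hE⟩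
    obtain ⟨f, rfl⟩ : ∃ e, Real.exp e = F := ⟨_, Real.exp_log hF⟩
    simp only [Real.sqrt_eq_rpow, ← Real.exp_mul, ← Real.exp_add]
    congr 1
    field_simp
    ring
  rw [e1] at h1
  rw [e2] at h3
  calc _ ≤ _ := add_le_add (h2.trans h3) h1
    _ = _ := by simp only [sub_self, Real.rpow_zero]; ring

lemma UNB {d : ℕ} (hd : 2 ≤ d) {γ : ℝ} (h0 : 0 < γ) (h1 : γ ≤ 1) (h2 : d = 2 → γ < 1) :
    ∃ C A B : ℝ, 0 ≤ C ∧ 0 < B ∧ B < A ∧ A + B = 1 + 2 * γ / d ∧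
    ∀ {η : Fin d → ℝ}, (∀ i, |η i| = 1) → ∀ {g h : V d → ℂ} {E F : ℝ}, Good g E → Good h F →
     ∀ {a : ℝ}, 0 < a → ‖RR η a g h‖ ≤ C * a ^ (γ - 1) * E ^ A * F ^ B := by
  have key : ∃ C A B : ℝ, 0 ≤ C ∧ 0 < B ∧ B < A ∧ A + B = 1 + 2 * γ / d ∧
    ∀ {η : Fin d → ℝ}, (∀ i, |η i| = 1) → ∀ {g h : V d → ℂ} {E F : ℝ}, Good g E → Good h F →
     0 < E → 0 < F → ∀ {a : ℝ}, 0 < a → ‖RR η a g h‖ ≤ C * a ^ (γ - 1) * E ^ A * F ^ B := by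
    rcases h1.lt_or_eq with h | rfl
    · exact Q4 hd h0 h
    · refine Q3 ?_
      rcases hd.lt_or_eq with h | h
      · exact h
      · exact absurd (h2 h.symm) (lt_irrefl _)
  obtain ⟨C, A, B, hC, hB, hBA, hs, H⟩ := key
  refine ⟨C, A, B, hC, hB, hBA, hs, ?_⟩
  intro η hη g h E F hg hh a ha
  have hE := hg.nonneg
  have hF := hh.nonneg
  rcases hE.eq_or_lt with rfl | hE'
  · rw [RR_zero_left η a hg, norm_zero]; positivity
  rcases hF.eq_or_lt with rfl | hF'
  · rw [RR_zero_right η a hh, norm_zero]; positivity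
  exact H hη hg hh hE' hF' ha

lemma RR_symm {d : ℕ} (η : Fin d → ℝ) {a : ℝ} (ha : 0 < a) (g h : V d → ℂ) :
    ‖RR η a g h‖ = ‖RR (fun i => -η i) a h g‖ := by
  have : RR (fun i => -η i) a h g = conj (RR η a g h) := by
    rw [RR, RR, ← integral_conj]
    congr 1
    ext ξ
    rw [Ph_Ioi_zero _ ha, Ph_Ioi_zero _ ha]
    have : zz (fun i => -η i) a ξ = conj (zz η a ξ) := by
      apply Complex.ext <;> simp [zz_re, zz_im, mm]
    rw [this]
    simp only [map_mul, map_div₀, map_neg, map_one, Complex.conj_conj]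
    ring
  rw [this, RCLike.norm_conj]

lemma fourier_sum {d : ℕ} {ι : Type*} (s : Finset ι) (w : ι → ℝ) {g : ι → V d → ℂ}
    (hg : ∀ k, Integrable (g k)) (ξ : V d) :
    𝓕 (fun x => ∑ k ∈ s, (w k : ℂ) * g k x) ξ = ∑ k ∈ s, (w k : ℂ) * 𝓕 (g k) ξ := by
  simp only [Real.fourier_eq]
  simp_rw [Finset.smul_sum]
  rw [integral_finsetSum]
  · congr 1; ext k
    rw [← integral_const_mul]
    congr 1; ext x
    rw [Circle.smul_def, Circle.smul_def, smul_eq_mul, smul_eq_mul]; ring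
  · intro k _
    exact (Real.fourierIntegral_convergent_iff ξ).2 ((hg k).const_mul _)

lemma good_sum {d : ℕ} {ι : Type*} (s : Finset ι) (w : ι → ℝ) {g : ι → V d → ℂ} {m : ι → ℝ}
    (hg : ∀ k, Good (g k) (m k)) : ∃ E, Good (fun x => ∑ k ∈ s, (w k : ℂ) * g k x) E := by
  refine ⟨max (∫ x, ‖∑ k ∈ s, (w k : ℂ) * g k x‖) (∫ x, ‖∑ k ∈ s, (w k : ℂ) * g k x‖ ^ 2),
    ?_, ?_, le_max_left _ _, le_max_right _ _⟩
  · exact integrable_finsetSum _ fun k _ => (hg k).int.const_mul _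
  · exact memLp_finsetSum _ fun k _ => (hg k).mem.const_mul _

lemma QQ_sum {d : ℕ} (η : Fin d → ℝ) {a : ℝ} (ha : 0 < a) {ι : Type*} (s : Finset ι) (w : ι → ℝ)
    (hw : ∀ k, 0 ≤ w k) {g : ι → V d → ℂ} {m : ι → ℝ}
    (hg : ∀ k, Good (g k) (m k)) :
    QQ η a (fun x => ∑ k ∈ s, (w k : ℂ) * g k x) ≤ ∑ k ∈ s, ∑ l ∈ s, w k * w l * ‖RR η a (g k) (g l)‖ := by
  obtain ⟨E, hE⟩ := good_sum s w hg
  refine (QQ_le η hE ha).trans ?_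
  have e : RR η a (fun x => ∑ k ∈ s, (w k : ℂ) * g k x) (fun x => ∑ k ∈ s, (w k : ℂ) * g k x) =
      ∑ k ∈ s, ∑ l ∈ s, (w k * w l : ℂ) * RR η a (g k) (g l) := by
    have hi : ∀ k l, Integrable (fun ξ => 𝓕 (g k) ξ * conj (𝓕 (g l) ξ) * Ph η a (Set.Ioi 0) ξ) := fun k l =>
      w_int (hg k) (hg l) (Ph_cont_Ioi η ha 0) (Ph_Ioi_bound' η ha le_rfl)
    simp only [RR, ← integral_const_mul]
    rw [integral_congr_ae (g := fun ξ => ∑ k ∈ s, ∑ l ∈ s, (w k * w l : ℂ) *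
      (𝓕 (g k) ξ * conj (𝓕 (g l) ξ) * Ph η a (Set.Ioi 0) ξ))]
    · rw [integral_finsetSum _ fun k _ => integrable_finsetSum _ fun l _ => (hi k l).const_mul _]
      refine Finset.sum_congr rfl fun k _ => ?_
      rw [integral_finsetSum _ fun l _ => (hi k l).const_mul _]
    · filter_upwards with ξ
      rw [fourier_sum s w (fun k => (hg k).int), map_sum, Finset.sum_mul_sum, Finset.sum_mul]
      refine Finset.sum_congr rfl fun k _ => ?_
      rw [Finset.sum_mul]
      refine Finset.sum_congr rfl fun l _ => ?_
      simp only [map_mul, Complex.conj_ofReal]; ring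
  rw [e]
  refine (norm_sum_le _ _).trans (Finset.sum_le_sum fun k _ => (norm_sum_le _ _).trans
    (Finset.sum_le_sum fun l _ => ?_))
  rw [norm_mul, norm_mul, Complex.norm_real, Complex.norm_real, Real.norm_of_nonneg (hw k), Real.norm_of_nonneg (hw l)]

lemma geo_sum {r : ℝ} (h0 : 0 ≤ r) (h1 : r < 1) : ∃ M : ℝ, 0 ≤ M ∧ ∀ (s : Finset ℤ) (k : ℤ),
    ∑ l ∈ s, r ^ (k - l).natAbs ≤ M := by
  set f : ℤ → ℝ := fun n => r ^ n.natAbs with hf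
  have hg := summable_geometric_of_lt_one h0 h1
  have hs : Summable f :=
    Summable.of_nat_of_neg (f := f) (by simpa [hf] using hg) (by simpa [hf] using hg)
  have hn : ∀ n, 0 ≤ f n := fun n => by rw [hf]; positivity
  refine ⟨∑' n : ℤ, f n, tsum_nonneg hn, fun s k => ?_⟩
  have h2 : Summable (fun l : ℤ => f (k - l)) := by
    have := (Equiv.subLeft k).summable_iff.2 hs
    exact this
  have h3 : ∑' l : ℤ, f (k - l) = ∑' n, f n := (Equiv.subLeft k).tsum_eq f
  rw [← h3]
  exact h2.sum_le_tsum s (fun _ _ => hn _)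

lemma dsum {A B q : ℝ} (hB : 0 < B) (hAB : B < A) (h1 : 1 ≤ A + B) (hq : 0 < q)
    (hqe : q * (A + B) = 2 * (q - 1)) : ∃ M : ℝ, 0 ≤ M ∧ ∀ (s : Finset ℤ) (m : ℤ → ℝ) (_ : ∀ k, 0 ≤ m k)
    (T : ℤ → ℤ → ℝ) (_ : ∀ k l, T k l ≤ m k ^ A * m l ^ B) (_ : ∀ k l, T k l ≤ m l ^ A * m k ^ B),
    ∑ k ∈ s, ∑ l ∈ s, (2 : ℝ) ^ (k * (q - 1)) * (2 : ℝ) ^ (l * (q - 1)) * T k l ≤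
      M * (∑ k ∈ s, (2 : ℝ) ^ (k * q) * m k) ^ (A + B) := by
  set r : ℝ := 2 ^ (-(q * (A - B) / 2)) with hr
  have hr0 : 0 < r := by positivity
  have hr1 : r < 1 := Real.rpow_lt_one_of_one_lt_of_neg (by norm_num) (by
    have := mul_pos hq (sub_pos.2 hAB); linarith)
  obtain ⟨M, hM, HM⟩ := geo_sum hr0.le hr1
  refine ⟨2 * M, by positivity, fun s m hm T hT1 hT2 => ?_⟩
  set S : ℤ → ℝ := fun k => (2 : ℝ) ^ (k * q) * m k with hS
  have hS0 : ∀ k, 0 ≤ S k := fun k => by have := hm k; positivity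
  have hmS : ∀ k, m k = 2 ^ (-(k * q)) * S k := fun k => by
    rw [hS]; simp only; rw [← mul_assoc, ← Real.rpow_add two_pos]; simp
  have one : ∀ k l : ℤ, l ≤ k → (2 : ℝ) ^ (k * (q - 1)) * (2 : ℝ) ^ (l * (q - 1)) * (m k ^ A * m l ^ B) ≤
      r ^ (k - l).natAbs * (S k ^ (A + B) + S l ^ (A + B)) := by
    intro k l hkl
    have e : (2 : ℝ) ^ (k * (q - 1)) * (2 : ℝ) ^ (l * (q - 1)) * (m k ^ A * m l ^ B) =
        r ^ (k - l).natAbs * (S k ^ A * S l ^ B) := by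
      have hn : (((k - l).natAbs : ℕ) : ℝ) = k - l := by
        have : (((k - l).natAbs : ℕ) : ℤ) = k - l := by omega
        have h := congrArg (fun z : ℤ => (z : ℝ)) this
        rw [Int.cast_natCast] at h
        rw [h]; push_cast; rfl
      rw [hmS k, hmS l, Real.mul_rpow (by positivity) (hS0 _), Real.mul_rpow (by positivity) (hS0 _),
        ← Real.rpow_natCast r, hn, hr]
      simp only [← Real.rpow_mul two_pos.le]
      have : (2 : ℝ) ^ (-(q * (A - B) / 2) * (k - l : ℝ)) =
        (2 : ℝ) ^ (k * (q - 1)) * (2 : ℝ) ^ (l * (q - 1)) * (2 ^ (-(k * q) * A) * 2 ^ (-(l * q) * B)) := by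
        rw [← Real.rpow_add two_pos, ← Real.rpow_add two_pos, ← Real.rpow_add two_pos]
        congr 1
        linear_combination (k + l) / 2 * hqe
      rw [this]; ring
    rw [e]
    gcongr
    have hA : 0 < A := by linarith
    rcases le_total (S k) (S l) with h | h
    · calc S k ^ A * S l ^ B ≤ S l ^ A * S l ^ B := by gcongr; exact Real.rpow_nonneg (hS0 _) _; exact hS0 _
        _ = S l ^ (A + B) := by rw [← Real.rpow_add_of_nonneg (hS0 _) hA.le hB.le]
        _ ≤ _ := by have := Real.rpow_nonneg (hS0 k) (A + B); linarith
    · calc S k ^ A * S l ^ B ≤ S k ^ A * S k ^ B := by gcongr; exact Real.rpow_nonneg (hS0 _) _; exact hS0 _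
        _ = S k ^ (A + B) := by rw [← Real.rpow_add_of_nonneg (hS0 _) hA.le hB.le]
        _ ≤ _ := by have := Real.rpow_nonneg (hS0 l) (A + B); linarith
  have two : ∀ k l : ℤ, (2 : ℝ) ^ (k * (q - 1)) * (2 : ℝ) ^ (l * (q - 1)) * T k l ≤
      r ^ (k - l).natAbs * S k ^ (A + B) + r ^ (k - l).natAbs * S l ^ (A + B) := by
    intro k l
    rw [← mul_add]
    rcases le_total l k with h | h
    · refine le_trans ?_ (one k l h)
      gcongr; exact hT1 k l
    · have := one l k h
      rw [show (k - l).natAbs = (l - k).natAbs by omega, add_comm]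
      refine le_trans ?_ this
      rw [mul_comm ((2 : ℝ) ^ (k * (q - 1)))]
      gcongr; exact hT2 k l
  have hp : ∑ k ∈ s, S k ^ (A + B) ≤ (∑ k ∈ s, S k) ^ (A + B) := by
    have hsum : 0 ≤ ∑ k ∈ s, S k := Finset.sum_nonneg fun k _ => hS0 k
    have e : ∀ x : ℝ, 0 ≤ x → x ^ (A + B) = x * x ^ (A + B - 1) := fun x hx => by
      rw [← Real.rpow_one_add' hx (by linarith)]; ring_nf
    rw [e _ hsum, Finset.sum_mul]
    refine Finset.sum_le_sum fun k hk => ?_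
    rw [e _ (hS0 k)]
    have : S k ≤ ∑ k ∈ s, S k := Finset.single_le_sum (fun k _ => hS0 k) hk
    have := hS0 k
    gcongr
  calc _ ≤ ∑ k ∈ s, ∑ l ∈ s, (r ^ (k - l).natAbs * S k ^ (A + B) + r ^ (k - l).natAbs * S l ^ (A + B)) :=
        Finset.sum_le_sum fun k _ => Finset.sum_le_sum fun l _ => two k l
    _ = ∑ k ∈ s, (∑ l ∈ s, r ^ (k - l).natAbs) * S k ^ (A + B) +
          ∑ l ∈ s, (∑ k ∈ s, r ^ (l - k).natAbs) * S l ^ (A + B) := by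
        simp only [Finset.sum_add_distrib, Finset.sum_mul]
        congr 1
        rw [Finset.sum_comm]
        refine Finset.sum_congr rfl fun l _ => Finset.sum_congr rfl fun k _ => ?_
        rw [show (k - l).natAbs = (l - k).natAbs by omega]
    _ ≤ ∑ k ∈ s, M * S k ^ (A + B) + ∑ l ∈ s, M * S l ^ (A + B) := by
        gcongr with k hk k hk
        · exact Real.rpow_nonneg (hS0 _) _
        · exact HM s k
        · exact Real.rpow_nonneg (hS0 _) _
        · exact HM s k
    _ = 2 * M * ∑ k ∈ s, S k ^ (A + B) := by rw [← Finset.mul_sum]; ring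
    _ ≤ _ := by gcongr

def EE {d : ℕ} (u : V d → ℂ) (k : ℤ) : Set (V d) := {x | (2 : ℝ) ^ k ≤ ‖u x‖ ∧ ‖u x‖ < 2 ^ (k + 1)}

noncomputable def gg {d : ℕ} (u : V d → ℂ) (k : ℤ) : V d → ℂ :=
  (EE u k).indicator (fun x => conj (u x) / ‖u x‖)

lemma EE_meas {d : ℕ} {u : V d → ℂ} (hu : Continuous u) (k : ℤ) : MeasurableSet (EE u k) := by
  have h1 : MeasurableSet {x | (2 : ℝ) ^ k ≤ ‖u x‖} := measurableSet_le measurable_const hu.norm.measurable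
  have h2 : MeasurableSet {x | ‖u x‖ < (2 : ℝ) ^ (k + 1)} := measurableSet_lt hu.norm.measurable measurable_const
  exact h1.inter h2

lemma EE_fin {d : ℕ} {u : V d → ℂ} (hi : Integrable u) (k : ℤ) : volume (EE u k) < ∞ := by
  refine lt_of_le_of_lt (measure_mono ?_) (hi.measure_norm_ge_lt_top (ε := (2 : ℝ) ^ k) (by positivity))
  intro x hx; exact hx.1

lemma EE_pos {d : ℕ} {u : V d → ℂ} {k : ℤ} {x : V d} (hx : x ∈ EE u k) : 0 < ‖u x‖ :=
  lt_of_lt_of_le (by positivity) hx.1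

lemma gg_norm {d : ℕ} (u : V d → ℂ) (k : ℤ) (x : V d) : ‖gg u k x‖ = (EE u k).indicator (fun _ => (1 : ℝ)) x := by
  by_cases hx : x ∈ EE u k
  · have := EE_pos hx
    simp [gg, hx, this.ne']
  · simp [gg, hx]

lemma gg_good {d : ℕ} {u : V d → ℂ} (hu : Continuous u) (hi : Integrable u) (k : ℤ) :
    Good (gg u k) (volume.real (EE u k)) := by
  have hm := EE_meas hu k
  have hsm : AEStronglyMeasurable (gg u k) volume := by
    refine AEStronglyMeasurable.indicator ?_ hm
    have h1 : Measurable (fun x => conj (u x) / (‖u x‖ : ℂ)) := by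
      have := hu.measurable
      exact (Complex.continuous_conj.measurable.comp this).div
        (Complex.measurable_ofReal.comp this.norm)
    exact h1.aestronglyMeasurable
  have h1 : Integrable ((EE u k).indicator (fun _ => (1 : ℝ))) :=
    (integrable_indicator_iff hm).2 (integrableOn_const (EE_fin hi k).ne)
  have h2 : ∫ x, (EE u k).indicator (fun _ => (1 : ℝ)) x = volume.real (EE u k) := by
    rw [integral_indicator hm]; simp
  have h3 : ∀ x, ‖gg u k x‖ ^ 2 = (EE u k).indicator (fun _ => (1 : ℝ)) x := by
    intro x; rw [gg_norm]
    by_cases hx : x ∈ EE u k <;> simp [hx]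
  refine ⟨h1.mono' hsm (by filter_upwards with x; rw [gg_norm]), ?_, ?_, ?_⟩
  · rw [← integrable_norm_rpow_iff hsm (by norm_num) (by norm_num)]
    refine h1.congr ?_
    filter_upwards with x
    rw [← h3]; simp
  · simp only [gg_norm]; exact h2.le
  · simp only [h3]; exact h2.le

lemma u_gg {d : ℕ} {u : V d → ℂ} (hu : Continuous u) (hi : Integrable u) (k : ℤ) :
    ∃ r : ℝ, (2 : ℝ) ^ (k : ℝ) * volume.real (EE u k) ≤ r ∧ ∫ x, u x * gg u k x = r ∧
      Integrable (fun x => u x * gg u k x) := by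
  have hm := EE_meas hu k
  have e : ∀ x, u x * gg u k x = (((EE u k).indicator (fun x => ‖u x‖) x : ℝ) : ℂ) := by
    intro x
    by_cases hx : x ∈ EE u k
    · have := (EE_pos hx).ne'
      have h' : (‖u x‖ : ℂ) ≠ 0 := by exact_mod_cast this
      simp only [gg, Set.indicator_of_mem hx]
      rw [← mul_div_assoc, Complex.mul_conj, Complex.normSq_eq_norm_sq]
      push_cast
      field_simp
    · simp [gg, hx]
  refine ⟨∫ x, (EE u k).indicator (fun x => ‖u x‖) x, ?_, ?_, ?_⟩
  · rw [integral_indicator hm, Real.rpow_intCast]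
    have := setIntegral_ge_of_const_le_real hm (EE_fin hi k).ne (fun x hx => (hx : x ∈ EE u k).1) hi.norm.integrableOn
    exact this
  · simp only [e]
    exact integral_ofReal
  · simp only [e]
    exact (hi.norm.indicator hm).ofReal

lemma dual_lower {d : ℕ} {u : V d → ℂ} (hu : Continuous u) (hi : Integrable u) (s : Finset ℤ) (q : ℝ) :
    ∑ k ∈ s, (2 : ℝ) ^ (k * q) * volume.real (EE u k) ≤
      ‖∫ x, u x * ∑ k ∈ s, (((2 : ℝ) ^ (k * (q - 1)) : ℝ) : ℂ) * gg u k x‖ := by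
  choose r hr1 hr2 hr3 using u_gg hu hi
  have e : ∫ x, u x * ∑ k ∈ s, (((2 : ℝ) ^ (k * (q - 1)) : ℝ) : ℂ) * gg u k x =
      ((∑ k ∈ s, (2 : ℝ) ^ (k * (q - 1)) * r k : ℝ) : ℂ) := by
    simp only [Finset.mul_sum]
    rw [integral_finsetSum]
    · push_cast
      refine Finset.sum_congr rfl fun k _ => ?_
      rw [← hr2, ← integral_const_mul]
      congr 1; ext x; push_cast; ring
    · intro k _
      refine ((hr3 k).const_mul (((2 : ℝ) ^ (k * (q - 1)) : ℝ) : ℂ)).congr ?_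
      filter_upwards with x; ring
  rw [e, Complex.norm_real]
  refine le_trans ?_ (le_abs_self _)
  refine Finset.sum_le_sum fun k _ => ?_
  have : (2 : ℝ) ^ (k * q) = 2 ^ (k * (q - 1)) * 2 ^ (k : ℝ) := by
    rw [← Real.rpow_add two_pos]; ring_nf
  rw [this, mul_assoc]
  gcongr
  exact hr1 k

lemma dual_upper {d : ℕ} (η : Fin d → ℝ) {v G : V d → ℂ} {E a : ℝ} (hv : Continuous v) (hvi : Integrable v)
    (hv2 : Integrable (fun ξ => ‖v ξ‖ ^ 2)) (hvm : Integrable (fun ξ => ‖v ξ‖ ^ 2 * mm η ξ ^ 2))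
    (hG : Good G E) (ha : 0 < a) :
    ‖∫ x, 𝓕 v x * G x‖ ≤ √(a * (∫ ξ, ‖v ξ‖ ^ 2) + a⁻¹ * ∫ ξ, ‖v ξ‖ ^ 2 * mm η ξ ^ 2) * √(QQ η a G) := by
  rw [fourier_flip hvi hG.int]
  have hmc := mm_cont η
  have hFc := fourier_cont hG.int
  have hpos : ∀ ξ, 0 < a ^ 2 + mm η ξ ^ 2 := fun ξ => by positivity
  set f : V d → ℂ := fun ξ => v ξ * (√((a ^ 2 + mm η ξ ^ 2) / a) : ℝ) with hf
  set g : V d → ℂ := fun ξ => 𝓕 G ξ * (√(a / (a ^ 2 + mm η ξ ^ 2)) : ℝ) with hg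
  have hfn : ∀ ξ, ‖f ξ‖ ^ 2 = a * ‖v ξ‖ ^ 2 + a⁻¹ * (‖v ξ‖ ^ 2 * mm η ξ ^ 2) := fun ξ => by
    have := hpos ξ
    rw [hf]; simp only [norm_mul, Complex.norm_real, mul_pow, Real.norm_eq_abs, sq_abs]
    rw [Real.sq_sqrt (by positivity)]; field_simp
  have hgn : ∀ ξ, ‖g ξ‖ ^ 2 = ‖𝓕 G ξ‖ ^ 2 * (a / (a ^ 2 + mm η ξ ^ 2)) := fun ξ => by
    have := hpos ξ
    rw [hg]; simp only [norm_mul, Complex.norm_real, mul_pow, Real.norm_eq_abs, sq_abs]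
    rw [Real.sq_sqrt (by positivity)]
  have hfc : Continuous f := by
    have : Continuous fun ξ => √((a ^ 2 + mm η ξ ^ 2) / a) := by fun_prop
    exact hv.mul (Complex.continuous_ofReal.comp this)
  have hgc : Continuous g := by
    have : Continuous fun ξ => √(a / (a ^ 2 + mm η ξ ^ 2)) :=
      (Continuous.div (by fun_prop) (by fun_prop) fun ξ => (hpos ξ).ne').sqrt
    exact hFc.mul (Complex.continuous_ofReal.comp this)
  have hf2 : MemLp f 2 := by
    rw [memLp_two_iff_integrable_sq_norm hfc.aestronglyMeasurable]
    simp only [hfn]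
    exact (hv2.const_mul _).add (hvm.const_mul _)
  have hg2 : MemLp g 2 := by
    rw [memLp_two_iff_integrable_sq_norm hgc.aestronglyMeasurable]
    simp only [hgn]
    exact QQ_int η hG ha
  have hfg : ∀ ξ, ‖v ξ * 𝓕 G ξ‖ = ‖f ξ‖ * ‖g ξ‖ := fun ξ => by
    have := hpos ξ
    rw [← norm_mul, hf, hg]; simp only
    congr 1
    have : (√((a ^ 2 + mm η ξ ^ 2) / a) : ℝ) * √(a / (a ^ 2 + mm η ξ ^ 2)) = 1 := by
      rw [← Real.sqrt_mul (by positivity)]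
      rw [div_mul_div_comm, mul_comm, div_self (by positivity), Real.sqrt_one]
    have h' : ((√((a ^ 2 + mm η ξ ^ 2) / a) : ℝ) : ℂ) * (√(a / (a ^ 2 + mm η ξ ^ 2)) : ℝ) = 1 := by
      exact_mod_cast this
    linear_combination -(v ξ * 𝓕 G ξ) * h'
  calc ‖∫ x, v x * 𝓕 G x‖ ≤ ∫ x, ‖v x * 𝓕 G x‖ := norm_integral_le_integral_norm _
    _ = ∫ x, ‖f x‖ * ‖g x‖ := by simp only [hfg]
    _ ≤ _ := cs_real hf2 hg2
    _ = _ := by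
      simp only [hfn, hgn]
      rw [integral_add (hv2.const_mul _) (hvm.const_mul _), integral_const_mul, integral_const_mul, QQ]

lemma core {d : ℕ} (hd : 2 ≤ d) {γ : ℝ} (h0 : 0 < γ) (h1 : γ ≤ 1) (h2 : d = 2 → γ < 1) :
    ∃ C : ℝ, 0 ≤ C ∧ ∀ (η : Fin d → ℝ), (∀ i, |η i| = 1) → ∀ {v : V d → ℂ}, Continuous v → Integrable v →
      Integrable (𝓕 v) → Integrable (fun ξ => ‖v ξ‖ ^ 2) → Integrable (fun ξ => ‖v ξ‖ ^ 2 * mm η ξ ^ 2) →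
      ∀ {a : ℝ}, 0 < a → ∀ s : Finset ℤ,
      (∑ k ∈ s, (2 : ℝ) ^ (k * (2 * d / (d - 2 * γ))) * volume.real (EE (𝓕 v) k)) ^ (1 - 2 * γ / d) ≤
      C * a ^ (γ - 1) * (a * (∫ ξ, ‖v ξ‖ ^ 2) + a⁻¹ * ∫ ξ, ‖v ξ‖ ^ 2 * mm η ξ ^ 2) := by
  have hd' : (2 : ℝ) ≤ d := by exact_mod_cast hd
  have hdγ : 2 * γ < d := by
    rcases h1.lt_or_eq with h | rfl
    · linarith
    · rcases hd.lt_or_eq with h | h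
      · have : (2 : ℝ) < d := by exact_mod_cast h
        linarith
      · exact absurd (h2 h.symm) (lt_irrefl _)
  obtain ⟨C, A, B, hC, hB, hBA, hAB, H⟩ := UNB hd h0 h1 h2
  set q : ℝ := 2 * d / (d - 2 * γ) with hq
  have hq0 : 0 < q := div_pos (by linarith) (by linarith)
  have hqe : q * (A + B) = 2 * (q - 1) := by
    rw [hAB, hq]
    have : (d : ℝ) - 2 * γ ≠ 0 := by linarith
    field_simp; ring
  obtain ⟨M, hM, HM⟩ := dsum hB hBA (by rw [hAB]; have : 0 ≤ 2 * γ / d := by positivity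
                                        linarith) hq0 hqe
  refine ⟨C * M, by positivity, fun η hη v hv hvi hui hv2 hvm a ha s => ?_⟩
  have huc := fourier_cont hvi
  set S := ∑ k ∈ s, (2 : ℝ) ^ (k * q) * volume.real (EE (𝓕 v) k) with hS
  set X := a * (∫ ξ, ‖v ξ‖ ^ 2) + a⁻¹ * ∫ ξ, ‖v ξ‖ ^ 2 * mm η ξ ^ 2 with hX
  have hX0 : 0 ≤ X := add_nonneg (mul_nonneg ha.le (integral_nonneg fun _ => by positivity))
    (mul_nonneg (by positivity) (integral_nonneg fun _ => by positivity))
  have hS0 : 0 ≤ S := Finset.sum_nonneg fun k _ => by positivity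
  have hg := fun k => gg_good huc hui k
  obtain ⟨E, hG⟩ := good_sum s (fun k : ℤ => (2 : ℝ) ^ (k * (q - 1))) hg
  have b1 := (dual_lower huc hui s q).trans (dual_upper η hv hvi hv2 hvm hG ha)
  have b2 := QQ_sum η ha s (fun k : ℤ => (2 : ℝ) ^ (k * (q - 1))) (fun k => by positivity) hg
  have hneg : ∀ i, |(fun i => -η i) i| = 1 := fun i => by simpa using hη i
  have hK : 0 ≤ C * a ^ (γ - 1) := by positivity
  have b3 : QQ η a (fun x => ∑ k ∈ s, (((2 : ℝ) ^ (k * (q - 1)) : ℝ) : ℂ) * gg (𝓕 v) k x) ≤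
      C * a ^ (γ - 1) * (M * S ^ (A + B)) := by
    refine b2.trans ?_
    have := HM s (fun k => volume.real (EE (𝓕 v) k)) (fun k => by positivity)
      (fun k l => min (volume.real (EE (𝓕 v) k) ^ A * volume.real (EE (𝓕 v) l) ^ B)
        (volume.real (EE (𝓕 v) l) ^ A * volume.real (EE (𝓕 v) k) ^ B))
      (fun k l => min_le_left _ _) (fun k l => min_le_right _ _)
    refine le_trans ?_ (mul_le_mul_of_nonneg_left this hK)
    rw [Finset.mul_sum]
    refine Finset.sum_le_sum fun k _ => ?_
    rw [Finset.mul_sum]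
    refine Finset.sum_le_sum fun l _ => ?_
    rw [mul_left_comm]
    gcongr
    rw [mul_min_of_nonneg _ _ hK]
    refine le_min ?_ ?_
    · have := H hη (hg k) (hg l) ha
      linarith
    · rw [RR_symm η ha]
      have := H hneg (hg l) (hg k) ha
      linarith
  have b4 : S ≤ √X * √(C * a ^ (γ - 1) * (M * S ^ (A + B))) := b1.trans (by gcongr)
  rcases hS0.eq_or_lt with hz | hpos
  · rw [← hz, Real.zero_rpow]
    · positivity
    · have : 2 * γ / d < 1 := by rw [div_lt_one (by linarith)]; linarith
      linarith
  have b5 : S ^ 2 ≤ X * (C * a ^ (γ - 1) * (M * S ^ (A + B))) := by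
    calc S ^ 2 ≤ (√X * √(C * a ^ (γ - 1) * (M * S ^ (A + B)))) ^ 2 := by gcongr
      _ = _ := by rw [mul_pow, Real.sq_sqrt hX0, Real.sq_sqrt (by positivity)]
  have e : S ^ 2 = S ^ (1 - 2 * γ / d) * S ^ (A + B) := by
    rw [← Real.rpow_add hpos, hAB]
    rw [show (1 - 2 * γ / d + (1 + 2 * γ / d) : ℝ) = ((2 : ℕ) : ℝ) by push_cast; ring, Real.rpow_natCast]
  rw [e] at b5
  have hSp : 0 < S ^ (A + B) := by positivity
  refine le_of_mul_le_mul_right (b5.trans (le_of_eq ?_)) hSp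
  ring

lemma lp_bound {d : ℕ} {u : V d → ℂ} (hu : Continuous u) (hi : Integrable u) {q T : ℝ} (hq : 0 < q) (hT : 0 ≤ T)
    (h : ∀ s : Finset ℤ, (∑ k ∈ s, (2 : ℝ) ^ (k * q) * volume.real (EE u k)) ^ (2 / q) ≤ T) :
    eLpNorm u (ENNReal.ofReal q) volume ≤ ENNReal.ofReal (2 * T ^ (1 / 2 : ℝ)) := by
  have h1 : ∫⁻ x, ‖u x‖ₑ ^ q ≤ ENNReal.ofReal (2 ^ q * T ^ (q / 2)) := by
    have hk : ∀ k : ℤ, ∫⁻ x in EE u k, ‖u x‖ₑ ^ q ≤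
        ENNReal.ofReal (2 ^ q * ((2 : ℝ) ^ (k * q) * volume.real (EE u k))) := by
      intro k
      have hb : ∀ x ∈ EE u k, ‖u x‖ₑ ^ q ≤ ENNReal.ofReal (2 ^ q * (2 : ℝ) ^ (k * q)) := by
        intro x hx
        rw [← ofReal_norm, ENNReal.ofReal_rpow_of_nonneg (norm_nonneg _) hq.le]
        apply ENNReal.ofReal_le_ofReal
        have e : (2 : ℝ) ^ q * (2 : ℝ) ^ (k * q) = ((2 : ℝ) ^ (k + 1)) ^ q := by
          rw [← Real.rpow_intCast, ← Real.rpow_mul two_pos.le, ← Real.rpow_add two_pos]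
          push_cast; ring_nf
        rw [e]
        have := hx.2.le
        gcongr
      calc _ ≤ ∫⁻ x in EE u k, ENNReal.ofReal (2 ^ q * (2 : ℝ) ^ (k * q)) :=
            setLIntegral_mono measurable_const hb
        _ = _ := by
            rw [setLIntegral_const, ← mul_assoc, ENNReal.ofReal_mul (q := volume.real _) (by positivity), Measure.real,
              ENNReal.ofReal_toReal (EE_fin hi k).ne]
    calc ∫⁻ x, ‖u x‖ₑ ^ q = ∫⁻ x in ⋃ k, EE u k, ‖u x‖ₑ ^ q := by
          symm
          apply setLIntegral_eq_of_support_subset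
          intro x hx
          have hx0 : u x ≠ 0 := by
            intro h0
            apply hx
            simp [h0, hq]
          obtain ⟨k, hk⟩ := exists_mem_Ico_zpow (norm_pos_iff.2 hx0) one_lt_two
          exact Set.mem_iUnion.2 ⟨k, hk⟩
      _ ≤ ∑' k, ∫⁻ x in EE u k, ‖u x‖ₑ ^ q := lintegral_iUnion_le _ _
      _ ≤ ∑' k : ℤ, ENNReal.ofReal (2 ^ q * ((2 : ℝ) ^ (k * q) * volume.real (EE u k))) :=
          ENNReal.tsum_le_tsum hk
      _ ≤ _ := by
          rw [ENNReal.tsum_eq_iSup_sum]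
          refine iSup_le fun s => ?_
          rw [← ENNReal.ofReal_sum_of_nonneg fun k _ => by positivity]
          apply ENNReal.ofReal_le_ofReal
          rw [← Finset.mul_sum]
          gcongr
          have hs := h s
          have hS0 : 0 ≤ ∑ k ∈ s, (2 : ℝ) ^ (k * q) * volume.real (EE u k) :=
            Finset.sum_nonneg fun k _ => by positivity
          have := Real.rpow_le_rpow (by positivity) hs (z := q / 2) (by positivity)
          rwa [← Real.rpow_mul hS0, div_mul_div_comm, mul_comm 2 q, div_self (by positivity), Real.rpow_one] at this
  rw [eLpNorm_eq_lintegral_rpow_enorm_toReal (by simpa using hq) (by simp), ENNReal.toReal_ofReal hq.le]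
  calc _ ≤ (ENNReal.ofReal (2 ^ q * T ^ (q / 2))) ^ (1 / q) := by gcongr
    _ = _ := by
      rw [ENNReal.ofReal_rpow_of_nonneg (by positivity) (by positivity), Real.mul_rpow (by positivity) (by positivity),
        ← Real.rpow_mul two_pos.le, ← Real.rpow_mul hT]
      congr 3
      · rw [mul_one_div, div_self hq.ne', Real.rpow_one]
      · field_simp

section box
open scoped LineDeriv

noncomputable def Bx {d : ℕ} (η : Fin d → ℝ) (u : 𝓢(V d, ℂ)) : 𝓢(V d, ℂ) :=
  ∑ i, (η i : ℂ) • (∂_{(EuclideanSpace.single i (1 : ℝ) : V d)} (∂_{(EuclideanSpace.single i (1 : ℝ) : V d)} u : 𝓢(V d, ℂ)) : 𝓢(V d, ℂ))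

lemma sum_app {d : ℕ} {ι : Type*} (s : Finset ι) (f : ι → 𝓢(V d, ℂ)) (x : V d) :
    (∑ i ∈ s, f i) x = ∑ i ∈ s, f i x := by
  classical
  induction s using Finset.induction_on with
  | empty => simp
  | insert a s ha ih => rw [Finset.sum_insert ha, Finset.sum_insert ha, _root_.add_apply, ih]

lemma Bx_inv {d : ℕ} (η : Fin d → ℝ) (u : 𝓢(V d, ℂ)) (ξ : V d) :
    (𝓕⁻ (Bx η u) : 𝓢(V d, ℂ)) ξ = -(mm η ξ : ℂ) * (𝓕⁻ u : 𝓢(V d, ℂ)) ξ := by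
  have h1 : (𝓕⁻ (Bx η u) : 𝓢(V d, ℂ)) = ∑ i, (η i : ℂ) • (𝓕⁻ (∂_{(EuclideanSpace.single i (1 : ℝ) : V d)} (∂_{(EuclideanSpace.single i (1 : ℝ) : V d)} u : 𝓢(V d, ℂ)) : 𝓢(V d, ℂ)) : 𝓢(V d, ℂ)) := by
    have := map_sum (FourierTransform.fourierInvCLM ℂ 𝓢(V d, ℂ))
      (fun i => (η i : ℂ) • (∂_{(EuclideanSpace.single i (1 : ℝ) : V d)} (∂_{(EuclideanSpace.single i (1 : ℝ) : V d)} u : 𝓢(V d, ℂ)) : 𝓢(V d, ℂ))) Finset.univ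
    simp only [map_smul] at this
    exact this
  have ht : ∀ i : Fin d, Function.HasTemperateGrowth (fun x : V d => inner ℝ x (EuclideanSpace.single i (1 : ℝ))) := by
    intro i; fun_prop
  rw [h1, sum_app]
  simp only [SchwartzMap.fourierInv_lineDerivOp_eq, _root_.smul_apply, SchwartzMap.smulLeftCLM_apply_apply (ht _)]
  simp only [mm, smul_eq_mul]
  push_cast
  rw [Finset.mul_sum, ← Finset.sum_neg_distrib, Finset.sum_mul]
  refine Finset.sum_congr rfl fun i _ => ?_
  have : inner ℝ ξ (EuclideanSpace.single i (1 : ℝ)) = ξ i := by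
    simp [PiLp.inner_apply]
  rw [this]
  simp only [Complex.real_smul]
  ring_nf
  rw [Complex.I_sq]; ring

lemma Bx_apply {d : ℕ} (η : Fin d → ℝ) (u : 𝓢(V d, ℂ)) (z : V d) :
    Bx η u z = ∑ i, (η i : ℂ) * iteratedFDeriv ℝ 2 (⇑u) z (fun _ => EuclideanSpace.single i (1 : ℝ)) := by
  rw [Bx, sum_app]
  refine Finset.sum_congr rfl fun i _ => ?_
  rw [_root_.smul_apply, smul_eq_mul, ← SchwartzMap.iteratedLineDerivOp_eq_iteratedFDeriv]
  rw [LineDeriv.iteratedLineDerivOp_succ_left, LineDeriv.iteratedLineDerivOp_succ_left]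
  rfl

end box

def et (d : ℕ) (i : Fin d) : ℝ := if (i : ℕ) = d - 1 then 1 else -1

lemma et_abs (d : ℕ) (i : Fin d) : |et d i| = 1 := by
  unfold et; split_ifs <;> simp

lemma Bx_et {d : ℕ} (hd : 2 ≤ d) (u : 𝓢(V d, ℂ)) (z : V d) (h1 : d - 1 < d) (h2 : d - 1 ≤ d) :
    iteratedFDeriv ℝ 2 (⇑u) z (fun _ => EuclideanSpace.single (⟨d - 1, h1⟩ : Fin d) (1 : ℝ)) -
      ∑ i : Fin (d - 1), iteratedFDeriv ℝ 2 (⇑u) z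
        (fun _ => EuclideanSpace.single (Fin.castLE h2 i) (1 : ℝ)) = Bx (et d) u z := by
  rw [Bx_apply]
  obtain ⟨n, rfl⟩ : ∃ n, d = n + 1 := ⟨d - 1, by omega⟩
  rw [Fin.sum_univ_castSucc]
  have e1 : et (n + 1) (Fin.last n) = 1 := by simp [et]
  have e2 : ∀ i : Fin n, et (n + 1) i.castSucc = -1 := fun i => by
    have := i.2
    simp [et, this.ne]
  simp only [e1, e2]
  push_cast
  simp only [neg_mul, one_mul, Finset.sum_neg_distrib]
  rw [sub_eq_neg_add]
  rfl

lemma el2 {d : ℕ} (f : 𝓢(V d, ℂ)) : eLpNorm (⇑f) 2 volume = ENNReal.ofReal ((∫ x, ‖f x‖ ^ 2) ^ (1 / 2 : ℝ)) := by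
  have := (f.memLp 2 volume).eLpNorm_eq_integral_rpow_norm (by norm_num) (by norm_num)
  rw [this]; simp

lemma sq_integrable {d : ℕ} (f : 𝓢(V d, ℂ)) : Integrable (fun x => ‖f x‖ ^ 2) :=
  (memLp_two_iff_integrable_sq_norm f.continuous.aestronglyMeasurable).1 (f.memLp 2 volume)

lemma main_pos {d : ℕ} (hd : 2 ≤ d) {γ : ℝ} (h0 : 0 < γ) (h1 : γ ≤ 1) (h2 : d = 2 → γ < 1) :
    ∃ C : ℝ, 0 < C ∧ ∀ u : 𝓢(V d, ℂ),
      eLpNorm (⇑u) (ENNReal.ofReal (2 * d / (d - 2 * γ))) volume ≤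
        ENNReal.ofReal (C * (∫ x, ‖Bx (et d) u x‖ ^ 2) ^ (γ / 4) * (∫ x, ‖u x‖ ^ 2) ^ ((1 - γ / 2) / 2)) := by
  have hd' : (2 : ℝ) ≤ d := by exact_mod_cast hd
  have hdγ : 2 * γ < d := by
    rcases h1.lt_or_eq with h | rfl
    · linarith
    · rcases hd.lt_or_eq with h | h
      · have : (2 : ℝ) < d := by exact_mod_cast h
        linarith
      · exact absurd (h2 h.symm) (lt_irrefl _)
  have hq0 : 0 < 2 * (d : ℝ) / (d - 2 * γ) := div_pos (by linarith) (by linarith)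
  obtain ⟨C, hC, H⟩ := core hd h0 h1 h2
  refine ⟨2 * (2 * (C + 1)) ^ (1 / 2 : ℝ), by positivity, fun u => ?_⟩
  set v : 𝓢(V d, ℂ) := 𝓕⁻ u with hv
  have huv : 𝓕 (⇑v) = ⇑u := by
    rw [← SchwartzMap.fourier_coe, hv, FourierTransform.fourier_fourierInv_eq]
  set N := ∫ x, ‖u x‖ ^ 2 with hN
  set M := ∫ x, ‖Bx (et d) u x‖ ^ 2 with hM
  have hN0 : 0 ≤ N := integral_nonneg fun _ => by positivity
  have hM0 : 0 ≤ M := integral_nonneg fun _ => by positivity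
  have eN : ∫ ξ, ‖v ξ‖ ^ 2 = N := by
    rw [← SchwartzMap.integral_norm_sq_fourier v, hv, FourierTransform.fourier_fourierInv_eq]
  have epw : ∀ ξ, ‖v ξ‖ ^ 2 * mm (et d) ξ ^ 2 = ‖(𝓕⁻ (Bx (et d) u) : 𝓢(V d, ℂ)) ξ‖ ^ 2 := by
    intro ξ
    rw [Bx_inv, norm_mul, norm_neg, Complex.norm_real, mul_pow, Real.norm_eq_abs, sq_abs, mul_comm]
  have eM : ∫ ξ, ‖v ξ‖ ^ 2 * mm (et d) ξ ^ 2 = M := by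
    simp only [epw]
    rw [← SchwartzMap.integral_norm_sq_fourier, FourierTransform.fourier_fourierInv_eq]
  have step : ∀ ε : ℝ, 0 < ε → eLpNorm (⇑u) (ENNReal.ofReal (2 * d / (d - 2 * γ))) volume ≤
      ENNReal.ofReal (2 * (2 * (C + 1)) ^ (1 / 2 : ℝ) * (M + ε) ^ (γ / 4) * (N + ε) ^ ((1 - γ / 2) / 2)) := by
    intro ε hε
    have hY : 0 < M + ε := by linarith
    have hZ : 0 < N + ε := by linarith
    set a := ((M + ε) / (N + ε)) ^ (1 / 2 : ℝ) with ha
    have ha0 : 0 < a := by positivity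
    set T := 2 * (C + 1) * (M + ε) ^ (γ / 2) * (N + ε) ^ (1 - γ / 2) with hT
    have hTb : C * a ^ (γ - 1) * (a * N + a⁻¹ * M) ≤ T := by
      calc C * a ^ (γ - 1) * (a * N + a⁻¹ * M) ≤ (C + 1) * a ^ (γ - 1) * (a * (N + ε) + a⁻¹ * (M + ε)) := by
            gcongr <;> linarith
        _ = T := by
            have e1 : a ^ (γ - 1) * (a * (N + ε)) = (M + ε) ^ (γ / 2) * (N + ε) ^ (1 - γ / 2) := by
              rw [ha]
              generalize M + ε = Y at *
              generalize N + ε = Z at *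
              obtain ⟨y, rfl⟩ : ∃ e, Real.exp e = Y := ⟨_, Real.exp_log hY⟩
              obtain ⟨z, rfl⟩ : ∃ e, Real.exp e = Z := ⟨_, Real.exp_log hZ⟩
              simp only [← Real.exp_mul, ← Real.exp_add, ← Real.exp_sub]
              congr 1; ring
            have e2 : a ^ (γ - 1) * (a⁻¹ * (M + ε)) = (M + ε) ^ (γ / 2) * (N + ε) ^ (1 - γ / 2) := by
              rw [ha]
              generalize M + ε = Y at *
              generalize N + ε = Z at *
              obtain ⟨y, rfl⟩ : ∃ e, Real.exp e = Y := ⟨_, Real.exp_log hY⟩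
              obtain ⟨z, rfl⟩ : ∃ e, Real.exp e = Z := ⟨_, Real.exp_log hZ⟩
              simp only [← Real.exp_mul, ← Real.exp_add, ← Real.exp_sub, ← Real.exp_neg]
              congr 1; ring
            rw [hT]
            linear_combination (C + 1) * e1 + (C + 1) * e2
    have hb := lp_bound (u := ⇑u) (T := T) u.continuous u.integrable hq0 (by positivity) (by
      intro s
      have := H (et d) (et_abs d) v.continuous v.integrable (by rw [huv]; exact u.integrable) (sq_integrable v)
        (by simp only [epw]; exact sq_integrable _) ha0 s
      rw [huv, eN, eM] at this
      rw [show 2 / (2 * d / (d - 2 * γ)) = 1 - 2 * γ / d by field_simp]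
      exact this.trans hTb)
    refine hb.trans (le_of_eq ?_)
    congr 1
    rw [hT, Real.mul_rpow (by positivity) (by positivity), Real.mul_rpow (by positivity) (by positivity),
      ← Real.rpow_mul hY.le, ← Real.rpow_mul hZ.le]
    rw [show γ / 2 * (1 / 2) = γ / 4 by ring, show (1 - γ / 2) * (1 / 2) = (1 - γ / 2) / 2 by ring]
    ring
  have hc : Continuous fun ε : ℝ => ENNReal.ofReal (2 * (2 * (C + 1)) ^ (1 / 2 : ℝ) * (M + ε) ^ (γ / 4) * (N + ε) ^ ((1 - γ / 2) / 2)) := by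
    refine ENNReal.continuous_ofReal.comp ((continuous_const.mul ?_).mul ?_)
    · exact (Real.continuous_rpow_const (by positivity)).comp (by fun_prop)
    · exact (Real.continuous_rpow_const (by linarith)).comp (by fun_prop)
  have ht := (hc.tendsto 0).mono_left (nhdsWithin_le_nhds (s := Set.Ioi 0))
  simp only [add_zero] at ht
  exact ge_of_tendsto ht (by filter_upwards [self_mem_nhdsWithin] with ε hε using step ε hε)

end GNWave



/-- Gagliardo-Nirenberg inequality for the wave operator (Theorem `thm:GN_wave`). -/
theorem gagliardo_nirenberg_wave
    (d : ℕ) (hd : 2 ≤ d) (κ : ℝ) (hκ1 : 1 / 2 ≤ κ) (hκ2 : κ ≤ 1)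
    (hd2 : d = 2 → 1 / 2 < κ) :
    ∃ C : ℝ, 0 < C ∧ ∀ u : SchwartzMap (EuclideanSpace ℝ (Fin d)) ℂ,
      eLpNorm (⇑u) (ENNReal.ofReal (2 * d / (d - 4 + 4 * κ))) volume ≤
        ENNReal.ofReal C *
        eLpNorm (fun z =>
            iteratedFDeriv ℝ 2 (⇑u) z
              (fun _ => EuclideanSpace.single (⟨d - 1, by omega⟩ : Fin d) (1 : ℝ)) -
            ∑ i : Fin (d - 1),
              iteratedFDeriv ℝ 2 (⇑u) z
                (fun _ => EuclideanSpace.single (Fin.castLE (by omega) i) (1 : ℝ)))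
          2 volume ^ (1 - κ) *
        eLpNorm (⇑u) 2 volume ^ κ := by
  rcases hκ2.lt_or_eq with hk | hk
  · obtain ⟨C, hC, H⟩ := GNWave.main_pos hd (γ := 2 * (1 - κ)) (by linarith) (by linarith)
      (fun h => by have := hd2 h; linarith)
    refine ⟨C, hC, fun u => ?_⟩
    simp only [GNWave.Bx_et hd u]
    have h1 := H u
    rw [show (d : ℝ) - 2 * (2 * (1 - κ)) = d - 4 + 4 * κ by ring] at h1
    refine h1.trans (le_of_eq ?_)
    have hM0 : 0 ≤ ∫ x, ‖GNWave.Bx (GNWave.et d) u x‖ ^ 2 := integral_nonneg fun _ => by positivity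
    have hN0 : 0 ≤ ∫ x, ‖u x‖ ^ 2 := integral_nonneg fun _ => by positivity
    rw [GNWave.el2, GNWave.el2, ENNReal.ofReal_rpow_of_nonneg (by positivity) (by linarith),
      ENNReal.ofReal_rpow_of_nonneg (by positivity) (by linarith), ← ENNReal.ofReal_mul (by positivity),
      ← ENNReal.ofReal_mul (by positivity), ← Real.rpow_mul hM0, ← Real.rpow_mul hN0]
    congr 3
    · congr 1; ring
    · ring
  · subst hk
    refine ⟨1, one_pos, fun u => ?_⟩
    have hd0 : (d : ℝ) ≠ 0 := by positivity
    rw [show 2 * (d : ℝ) / (d - 4 + 4 * 1) = 2 by ring_nf; field_simp]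
    simp
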